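/- There exists an absolute constant β₀ and ε_β > 0 with ε_β → 0 as β → ∞ such that for β > β₀ and every integer k: if λ < λ_c^{(k−1)} then (1−ε_β)(λ_c^{(k−1)} − λ) ≤ f^tr_k(λ) − f^tr_{k−1}(λ) ≤ (1+ε_β)(λ_c^{(k−1)} − λ); and if λ > λ_c^{(k)} then (1−ε_β)(λ − λ_c^{(k)}) ≤ f^tr_k(λ) − f^tr_{k+1}(λ) ≤ (1+ε_β)(λ − λ_c^{(k)}). -/

import Mathlib

open scoped BigOperators
open Filter

noncomputable section

attribute [local instance] Classical.propDecidable

/-! ### Basic geometry of the square lattice -/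

/-- Sites of the square lattice `ℤ²`. -/
abbrev Site := ℤ × ℤ

/-- The four unit directions. -/
def dirs : Finset Site := {(1, 0), (-1, 0), (0, 1), (0, -1)}

/-- The box `Λ_n = ⟦-n/2, n/2⟧² ∩ ℤ²`. -/
def box (n : ℕ) : Finset Site :=
  Finset.Icc (-((n : ℤ) / 2)) ((n : ℤ) / 2) ×ˢ Finset.Icc (-((n : ℤ) / 2)) ((n : ℤ) / 2)

/-- SOS gradient energy of a height function on a domain `V`: each nearest-neighbour
edge with at least one endpoint in `V` contributes the absolute height gradient
(the directed sum below counts internal edges twice, whence the factor `1/2`). -/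
def sosEnergy (V : Finset Site) (ψ : Site → ℤ) : ℝ :=
  ∑ v ∈ V, ∑ d ∈ dirs,
    (if v + d ∈ V then (1 : ℝ) / 2 else 1) * |(ψ v : ℝ) - (ψ (v + d) : ℝ)|

/-- The bulk field term `Σ_{v ∈ V} ψ_v`. -/
def sosField (V : Finset Site) (ψ : Site → ℤ) : ℝ := ∑ v ∈ V, (ψ v : ℝ)

/-- The SOS weight `exp(-β Σ|∇ψ| - λ Σ ψ)`. -/
def sosWt (β lam : ℝ) (V : Finset Site) (ψ : Site → ℤ) : ℝ :=
  Real.exp (-(β * sosEnergy V ψ + lam * sosField V ψ))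

/-- The inner boundary `∂_i V`. -/
def innerBdry (V : Finset Site) : Finset Site :=
  V.filter fun v => ∃ d ∈ dirs, v + d ∉ V

/-- The interior `V̊ = V ∖ ∂_i V`. -/
def interiorSites (V : Finset Site) : Finset Site := V \ innerBdry V

/-- The number of edges `|∂_e V|` between `V` and its complement. -/
def edgeBdryCard (V : Finset Site) : ℕ :=
  ∑ v ∈ V, (dirs.filter fun d => v + d ∉ V).card

/-- Nearest-neighbour adjacency. -/
def adjS (u v : Site) : Prop := v - u ∈ dirs

/-- A set of sites is connected (as a subgraph of `ℤ²`). -/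
def connectedIn (S : Set Site) : Prop :=
  ∀ x ∈ S, ∀ y ∈ S,
    Relation.ReflTransGen (fun a b => adjS a b ∧ a ∈ S ∧ b ∈ S) x y

/-- A finite set of sites is simply connected: it is connected and its complement is
connected. -/
def SimplyConn (V : Finset Site) : Prop :=
  connectedIn (↑V : Set Site) ∧ connectedIn ((↑V : Set Site)ᶜ)

/-! ### SOS measures with a boundary signing -/

/-- A boundary signing value: `+`, `-`, `∅` or free. -/
inductive BSign | plus | minus | zero | free

/-- The constraint imposed at an inner-boundary site by a signing, for boundary height
`h`: `+` forces `≥ h`, `-` forces `≤ h`, `∅` forces `= h`, and `f` forces nothing. -/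
def BSign.ok : BSign → ℤ → ℤ → Prop
  | .plus, h, t => h ≤ t
  | .minus, h, t => t ≤ h
  | .zero, h, t => t = h
  | .free, _, _ => True

/-- Height functions with boundary condition identically `h` outside `V`, floor `0`
on `V` (and no ceiling), compatible with the boundary signing `η` along `∂_i V`. -/
def signedConfigs (V : Finset Site) (η : Site → BSign) (h : ℤ) : Set (Site → ℤ) :=
  {ψ | (∀ x, x ∉ V → ψ x = h) ∧ (∀ v ∈ V, 0 ≤ ψ v) ∧
       ∀ v ∈ innerBdry V, BSign.ok (η v) h (ψ v)}

/-- The partition function `Z_{η,h,V}`. -/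
def Zsos (β lam : ℝ) (η : Site → BSign) (h : ℤ) (V : Finset Site) : ℝ :=
  ∑' ψ : Site → ℤ, Set.indicator (signedConfigs V η h) (sosWt β lam V) ψ

/-- Probability of an event under the SOS measure `μ_{η,h,V}`. -/
def Psos (β lam : ℝ) (η : Site → BSign) (h : ℤ) (V : Finset Site)
    (E : Set (Site → ℤ)) : ℝ :=
  (∑' ψ : Site → ℤ, Set.indicator (signedConfigs V η h ∩ E) (sosWt β lam V) ψ) /
    Zsos β lam η h V

/-! ### Contours -/

/-- A (signed geometric) contour, encoded by the finite set of sites it encloses and its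
sign (up/down); the contour itself is the dual circuit `(∂_e Int)^*`. -/
structure Contour where
  int : Finset Site
  up : Bool

/-- The length `|γ|` of a contour: the number of boundary edges of its interior. -/
def Contour.len (γ : Contour) : ℕ := edgeBdryCard γ.int

/-- A valid contour encloses a nonempty simply-connected set of sites. -/
def Contour.valid (γ : Contour) : Prop :=
  γ.int.Nonempty ∧ connectedIn (↑γ.int : Set Site) ∧ connectedIn ((↑γ.int : Set Site)ᶜ)

/-- The constant boundary signing. -/
def constSign (s : BSign) : Site → BSign := fun _ => s

/-- The `h`-renormalized weight `W^rn_h(γ)`. -/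
def Wrn (β lam : ℝ) (h : ℤ) (γ : Contour) : ℝ :=
  if γ.up then
    Real.exp (-β * (γ.len : ℝ)) *
      (Zsos β lam (constSign .plus) (h + 1) γ.int / Zsos β lam (constSign .plus) h γ.int)
  else
    Real.exp (-β * (γ.len : ℝ)) *
      (Zsos β lam (constSign .minus) (h - 1) γ.int / Zsos β lam (constSign .minus) h γ.int)

/-- The `h`-truncated weight `W^tr_h(γ) = min{W^rn_h(γ), e^{-(β-5)|γ|}}`. -/
def Wtr (β lam : ℝ) (h : ℤ) (γ : Contour) : ℝ :=
  min (Wrn β lam h γ) (Real.exp (-(β - 5) * (γ.len : ℝ)))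

/-- The elementary diameter bound `min{λ⁻¹, e^{3β(h+1)}}`. -/
def elemBound (β lam : ℝ) (h : ℤ) : ℝ := min (1 / lam) (Real.exp (3 * β * ((h : ℝ) + 1)))

/-- A set of sites is `h`-elementary small: the enclosing contour (whose ℓ∞-diameter is
one more than that of the enclosed set) has diameter at most `min{λ⁻¹, e^{3β(h+1)}}`. -/
def elemSet (β lam : ℝ) (h : ℤ) (S : Set Site) : Prop :=
  ∀ x ∈ S, ∀ y ∈ S,
    ((max |x.1 - y.1| |x.2 - y.2| : ℤ) : ℝ) + 1 ≤ elemBound β lam h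

/-- A contour is `h`-elementary if `diam(γ) ≤ min{λ⁻¹, e^{3β(h+1)}}`. -/
def IsElem (β lam : ℝ) (h : ℤ) (γ : Contour) : Prop := elemSet β lam h (↑γ.int : Set Site)

/-- Two finite sets of sites share a (primal, equivalently dual) boundary edge. -/
def shareEdge (A B : Finset Site) : Prop :=
  ∃ v, ∃ d ∈ dirs, (v ∈ A ∧ v + d ∉ A) ∧ ((v ∈ B ∧ v + d ∉ B) ∨ (v + d ∈ B ∧ v ∉ B))

/-- Compatibility of a pair of signed contours: they may not cross, and if they overlap
on an edge their signs agree when nested and differ when mutually external. -/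
def compatPair (γ γ' : Contour) : Prop :=
  (γ.int ⊆ γ'.int ∨ γ'.int ⊆ γ.int ∨ Disjoint γ.int γ'.int) ∧
  (shareEdge γ.int γ'.int →
    ((γ.int ⊆ γ'.int ∨ γ'.int ⊆ γ.int) → γ.up = γ'.up) ∧
    (Disjoint γ.int γ'.int → γ.up ≠ γ'.up))

/-- Admissible renormalized families of signed contours in `U`, compatible with the
boundary signing `η` at reference height `h` (no floor constraint except that no
down-contours are allowed when `h = 0`). -/
def famOK (η : Site → BSign) (h : ℤ) (U : Finset Site) (Γ : Multiset Contour) : Prop :=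
  (∀ γ ∈ Γ, Contour.valid γ ∧ γ.int ⊆ U) ∧
  (∀ γ ∈ Γ, ∀ γ' ∈ Γ, compatPair γ γ') ∧
  (∀ v ∈ innerBdry U, ∀ γ ∈ Γ, v ∈ γ.int →
    (γ.up = true → η v ≠ BSign.minus ∧ η v ≠ BSign.zero) ∧
    (γ.up = false → η v ≠ BSign.plus ∧ η v ≠ BSign.zero)) ∧
  (h = 0 → ∀ γ ∈ Γ, γ.up = true)

/-- The product of weights of a family of contours. -/
def prodW (w : Contour → ℝ) (Γ : Multiset Contour) : ℝ := (Γ.map w).prod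

/-- The truncated partition function `Z^tr_{η,h,U}`. -/
def Ztr (β lam : ℝ) (η : Site → BSign) (h : ℤ) (U : Finset Site) : ℝ :=
  Real.exp (-lam * (h : ℝ) * (U.card : ℝ)) *
    ∑' Γ : Multiset Contour, Set.indicator {Γ | famOK η h U Γ} (prodW (Wtr β lam h)) Γ

/-- The renormalized partition function `Z^rn_{η,h,U}`. -/
def Zrn (β lam : ℝ) (η : Site → BSign) (h : ℤ) (U : Finset Site) : ℝ :=
  Real.exp (-lam * (h : ℝ) * (U.card : ℝ)) *
    ∑' Γ : Multiset Contour, Set.indicator {Γ | famOK η h U Γ} (prodW (Wrn β lam h)) Γ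

/-- The renormalized elementary partition function `Z^{rn.el}_{η,h,U}`. -/
def Zrnel (β lam : ℝ) (η : Site → BSign) (h : ℤ) (U : Finset Site) : ℝ :=
  Real.exp (-lam * (h : ℝ) * (U.card : ℝ)) *
    ∑' Γ : Multiset Contour,
      Set.indicator {Γ | famOK η h U Γ ∧ ∀ γ ∈ Γ, IsElem β lam h γ}
        (prodW (Wrn β lam h)) Γ

/-! ### Elementary restriction of the SOS measure -/

/-- `*`-adjacency (adjacency allowing diagonal steps). -/
def starAdj (u v : Site) : Prop := u ≠ v ∧ |u.1 - v.1| ≤ 1 ∧ |u.2 - v.2| ≤ 1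

/-- The `*`-connected component of `x` within `S`. -/
def compStar (S : Set Site) (x : Site) : Set Site :=
  {y | Relation.ReflTransGen (fun a b => starAdj a b ∧ a ∈ S ∧ b ∈ S) x y}

/-- The fill of a set of sites: the set together with all sites whose
complement-component is finite. -/
def fill (C : Set Site) : Set Site :=
  C ∪ {x | {y | Relation.ReflTransGen (fun a b => adjS a b ∧ a ∉ C ∧ b ∉ C) x y}.Finite}

/-- All outermost contours of the configuration `ψ` (with boundary height `h` on `V`)
are `h`-elementary: every filled deviation component is elementary-small. -/
def allOuterElem (β lam : ℝ) (h : ℤ) (V : Finset Site) (ψ : Site → ℤ) : Prop :=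
  ∀ v ∈ V, ψ v ≠ h → elemSet β lam h (fill (compStar {u : Site | u ∈ V ∧ ψ u ≠ h} v))

/-- The elementary partition function `Z^el_{η,h,V}`: the contribution to `Z_{η,h,V}`
of configurations all of whose outermost contours are `h`-elementary. -/
def Zel (β lam : ℝ) (η : Site → BSign) (h : ℤ) (V : Finset Site) : ℝ :=
  ∑' ψ : Site → ℤ,
    Set.indicator (signedConfigs V η h ∩ {ψ | allOuterElem β lam h V ψ})
      (sosWt β lam V) ψ

/-! ### Truncated free energies and the critical sequence -/

/-- `ftr h` is the truncated free energy `f^tr_h(λ)`: the infinite-volume limit of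
`|Λ_n|⁻¹ log Z^tr_{η,h,Λ_n}`, for every boundary signing. -/
def FTRlimit (β : ℝ) (ftr : ℕ → ℝ → ℝ) : Prop :=
  ∀ h : ℕ, ∀ lam : ℝ, 0 < lam → lam ≤ 1 → ∀ η : Site → BSign,
    Tendsto (fun n => Real.log (Ztr β lam η (h : ℤ) (box n)) / ((box n).card : ℝ))
      atTop (nhds (ftr h lam))

/-- `lamc` is the strictly decreasing sequence `(λ_c^{(k)})_{k≥0}` of critical points,
tending to `0`, at which the truncated free energies `ftr` exchange maximizer. -/
def CritSeq (ftr : ℕ → ℝ → ℝ) (lamc : ℕ → ℝ) : Prop :=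
  StrictAnti lamc ∧ (∀ i, 0 < lamc i) ∧ Tendsto lamc atTop (nhds 0) ∧
  (∀ i : ℕ, ∀ lam : ℝ, 0 < lam → lam ≤ 1 → lamc i < lam →
    (i = 0 ∨ lam < lamc (i - 1)) → ∀ j : ℕ, j ≠ i → ftr j lam < ftr i lam) ∧
  (∀ i : ℕ, ftr (i + 1) (lamc i) = ftr i (lamc i) ∧
    ∀ j : ℕ, j ≠ i → j ≠ i + 1 → ftr j (lamc i) < ftr i (lamc i))

/-- `d(x) = min_k |λ_c^{(k)} - x|`. -/
def dmin (lamc : ℕ → ℝ) (x : ℝ) : ℝ := ⨅ k : ℕ, |lamc k - x|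

/-- `d⁺(x) = min{λ_c^{(k)} - x : λ_c^{(k)} > x}`. -/
def dplus (lamc : ℕ → ℝ) (x : ℝ) : ℝ := sInf {y : ℝ | ∃ k, x < lamc k ∧ y = lamc k - x}

/-! ### SOS measures with general boundary conditions (floor 0, no ceiling) -/

/-- Height functions equal to the boundary condition `φ` off `V` and nonnegative on `V`. -/
def bcConfigs (V : Finset Site) (φ : Site → ℤ) : Set (Site → ℤ) :=
  {ψ | (∀ x, x ∉ V → ψ x = φ x) ∧ ∀ v ∈ V, 0 ≤ ψ v}

/-- The partition function with boundary condition `φ`. -/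
def Zbc (β lam : ℝ) (V : Finset Site) (φ : Site → ℤ) : ℝ :=
  ∑' ψ : Site → ℤ, Set.indicator (bcConfigs V φ) (sosWt β lam V) ψ

/-- Probability of an event under the SOS measure `μ_{φ,V}` (floor 0, no ceiling). -/
def Pbc (β lam : ℝ) (V : Finset Site) (φ : Site → ℤ) (E : Set (Site → ℤ)) : ℝ :=
  (∑' ψ : Site → ℤ, Set.indicator (bcConfigs V φ ∩ E) (sosWt β lam V) ψ) /
    Zbc β lam V φ

/-! ### Glauber dynamics on the box with a ceiling -/

/-- A configuration on `Λ_n` with floor `0` and ceiling `ℓ`. -/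
abbrev Cfg (n ℓ : ℕ) := {x : Site // x ∈ box n} → Fin (ℓ + 1)

/-- Extension of a configuration by the zero boundary condition. -/
def cExt {n ℓ : ℕ} (ψ : Cfg n ℓ) : Site → ℤ :=
  fun x => if h : x ∈ box n then ((ψ ⟨x, h⟩ : ℕ) : ℤ) else 0

/-- The weight of a configuration (zero boundary conditions). -/
def cWt (n ℓ : ℕ) (β lam : ℝ) (ψ : Cfg n ℓ) : ℝ := sosWt β lam (box n) (cExt ψ)

/-- The partition function on `Λ_n` with ceiling `ℓ` and zero boundary conditions. -/
def cZ (n ℓ : ℕ) (β lam : ℝ) : ℝ := ∑ ψ : Cfg n ℓ, cWt n ℓ β lam ψ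

/-- The SOS probability measure `μ_{n,λ}` (ceiling `ℓ`, zero boundary conditions). -/
def cPi (n ℓ : ℕ) (β lam : ℝ) (ψ : Cfg n ℓ) : ℝ := cWt n ℓ β lam ψ / cZ n ℓ β lam

/-- Probability of an event under `μ_{n,λ}`. -/
def cProb (n ℓ : ℕ) (β lam : ℝ) (E : Set (Cfg n ℓ)) : ℝ :=
  (∑ ψ : Cfg n ℓ, if ψ ∈ E then cWt n ℓ β lam ψ else 0) / cZ n ℓ β lam

/-- The Glauber (heat-bath) jump rate from `ψ` to `ψ' ≠ ψ`: nonzero only if they differ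
at a single site `v` by exactly one, in which case `v`'s height is resampled among
`{ψ_v - 1, ψ_v, ψ_v + 1}` (truncated at the floor and the ceiling) according to the
conditional probabilities given the other heights. -/
def glRate (n ℓ : ℕ) (β lam : ℝ) (ψ ψ' : Cfg n ℓ) : ℝ :=
  if ψ = ψ' then 0
  else
    ∑ v : {x : Site // x ∈ box n},
      if (∀ u, u ≠ v → ψ u = ψ' u) ∧ (((ψ' v : ℕ) : ℤ) - ((ψ v : ℕ) : ℤ)) ^ 2 = 1 then
        cWt n ℓ β lam ψ' /
          ∑ t : Fin (ℓ + 1),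
            (if (((t : ℕ) : ℤ) - ((ψ v : ℕ) : ℤ)) ^ 2 ≤ 1 then
              cWt n ℓ β lam (Function.update ψ v t) else 0)
      else 0

/-- Mean of an observable under `μ_{n,λ}`. -/
def cMean (n ℓ : ℕ) (β lam : ℝ) (f : Cfg n ℓ → ℝ) : ℝ :=
  ∑ ψ : Cfg n ℓ, cPi n ℓ β lam ψ * f ψ

/-- Variance of an observable under `μ_{n,λ}`. -/
def cVar (n ℓ : ℕ) (β lam : ℝ) (f : Cfg n ℓ → ℝ) : ℝ :=
  ∑ ψ : Cfg n ℓ, cPi n ℓ β lam ψ * (f ψ - cMean n ℓ β lam f) ^ 2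

/-- The Dirichlet form of the Glauber dynamics. -/
def cDirichlet (n ℓ : ℕ) (β lam : ℝ) (f : Cfg n ℓ → ℝ) : ℝ :=
  (1 / 2) * ∑ ψ : Cfg n ℓ, ∑ ψ' : Cfg n ℓ,
    cPi n ℓ β lam ψ * glRate n ℓ β lam ψ ψ' * (f ψ' - f ψ) ^ 2

/-- The spectral gap `gap_{n,λ}` of the generator of the Glauber dynamics (ceiling `ℓ`):
by reversibility, the smallest nonzero eigenvalue of minus the generator equals the
infimum of the Rayleigh quotients `E(f,f)/Var(f)`. -/
def specGap (n ℓ : ℕ) (β lam : ℝ) : ℝ :=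
  sInf {r : ℝ | ∃ f : Cfg n ℓ → ℝ,
    cVar n ℓ β lam f ≠ 0 ∧ r = cDirichlet n ℓ β lam f / cVar n ℓ β lam f}

end

section PeierlsPart

attribute [local instance] Classical.propDecidable

/-- The closed `ℓ∞`-ball of radius one. -/
noncomputable def nb9 (s : Site) : Finset Site :=
  Finset.Icc (s.1 - 1) (s.1 + 1) ×ˢ Finset.Icc (s.2 - 1) (s.2 + 1)

lemma nb9_card (s : Site) : (nb9 s).card = 9 := by
  simp only [nb9, Finset.card_product, Int.card_Icc]
  have h1 : s.1 + 1 + 1 - (s.1 - 1) = 3 := by ring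
  have h2 : s.2 + 1 + 1 - (s.2 - 1) = 3 := by ring
  rw [h1, h2]; rfl

lemma mem_nb9 (a b : Site) :
    b ∈ nb9 a ↔ (a.1 - 1 ≤ b.1 ∧ b.1 ≤ a.1 + 1) ∧ (a.2 - 1 ≤ b.2 ∧ b.2 ≤ a.2 + 1) := by
  simp [nb9, Finset.mem_product]

/-- Walks with `n` steps started at `s`. -/
noncomputable def walks : ℕ → Site → Finset (List Site)
  | 0, s => {[s]}
  | n + 1, s => (nb9 s).biUnion fun f => (walks n f).image (fun l => s :: l)

lemma walks_card (n : ℕ) : ∀ s, (walks n s).card ≤ 9 ^ n := by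
  induction n with
  | zero => intro s; simp [walks]
  | succ n ih =>
    intro s
    rw [walks]
    refine Finset.card_biUnion_le.trans ?_
    calc ∑ f ∈ nb9 s, ((walks n f).image (fun l => s :: l)).card
        ≤ ∑ f ∈ nb9 s, 9 ^ n :=
          Finset.sum_le_sum fun f _ => Finset.card_image_le.trans (ih f)
      _ = 9 ^ (n + 1) := by rw [Finset.sum_const, nb9_card]; simp [pow_succ, mul_comm]

lemma mem_walks : ∀ (l : List Site) (s : Site),
    List.IsChain (fun a b => b ∈ nb9 a) (s :: l) → (s :: l) ∈ walks l.length s := by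
  intro l
  induction l with
  | nil => intro s _; simp [walks]
  | cons a l ih =>
    intro s h
    rw [List.isChain_cons_cons] at h
    simp only [List.length_cons, walks, Finset.mem_biUnion, Finset.mem_image]
    exact ⟨a, h.1, a :: l, ih a h.2, rfl⟩

lemma nb9_symm {a b : Site} (h : b ∈ nb9 a) : a ∈ nb9 b := by
  rw [mem_nb9] at *; omega

lemma cover_aux (S : Finset Site) (u : Site) (hu : u ∈ S)
    (conn : ∀ T ⊆ S, u ∈ T → (∀ a ∈ T, ∀ b ∈ S, b ∈ nb9 a → b ∈ T) → T = S) (j : ℕ) :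
    j < S.card → ∃ l : List Site, List.IsChain (fun a b => b ∈ nb9 a) (u :: l) ∧
      l.length = 2 * j ∧ (u :: l).toFinset ⊆ S ∧ (u :: l).toFinset.card = j + 1 := by
  induction j with
  | zero => intro _; exact ⟨[], by simp, rfl, by simpa using hu, by simp⟩
  | succ j ih =>
    intro hj
    obtain ⟨l, hc, hl, hS, hcard⟩ := ih (by omega)
    have hne : (u :: l).toFinset ≠ S := by intro h; rw [h] at hcard; omega
    have : ∃ a ∈ (u :: l).toFinset, ∃ b ∈ S, b ∈ nb9 a ∧ b ∉ (u :: l).toFinset := by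
      by_contra hcon
      push Not at hcon
      exact hne (conn _ hS (by simp) fun a ha b hb hab => hcon a ha b hb hab)
    obtain ⟨a, ha, b, hb, hab, hbn⟩ := this
    have key : ∃ l' : List Site, List.IsChain (fun a b => b ∈ nb9 a) (u :: l') ∧
        l'.length = l.length + 2 ∧ ∀ x, x ∈ u :: l' ↔ x = b ∨ x ∈ u :: l := by
      obtain ⟨l1, l2, h12⟩ := List.append_of_mem (List.mem_toFinset.1 ha)
      cases l1 with
      | nil =>
        simp only [List.nil_append, List.cons.injEq] at h12
        obtain ⟨rfl, rfl⟩ := h12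
        refine ⟨b :: u :: l, ?_, by simp, ?_⟩
        · simp only [List.isChain_cons_cons]
          exact ⟨hab, nb9_symm hab, hc⟩
        · intro x; simp; tauto
      | cons c l1 =>
        simp only [List.cons_append, List.cons.injEq] at h12
        obtain ⟨rfl, rfl⟩ := h12
        refine ⟨l1 ++ a :: b :: a :: l2, ?_, by simp; omega, ?_⟩
        · have e : u :: (l1 ++ a :: l2) = (u :: l1) ++ a :: l2 := rfl
          have e' : u :: (l1 ++ a :: b :: a :: l2) = (u :: l1) ++ a :: b :: a :: l2 := rfl
          rw [e, List.isChain_split] at hc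
          rw [e', List.isChain_split]
          refine ⟨hc.1, ?_⟩
          simp only [List.isChain_cons_cons]
          exact ⟨hab, nb9_symm hab, hc.2⟩
        · intro x; simp; tauto
    obtain ⟨l', h1, h2, h3⟩ := key
    have hins : (u :: l').toFinset = insert b (u :: l).toFinset := by
      ext x; rw [List.mem_toFinset, h3, Finset.mem_insert, List.mem_toFinset]
    refine ⟨l', h1, by omega, ?_, ?_⟩
    · rw [hins]; exact Finset.insert_subset hb hS
    · rw [hins, Finset.card_insert_of_notMem hbn, hcard]

lemma cover (S : Finset Site) (u : Site) (hu : u ∈ S)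
    (conn : ∀ T ⊆ S, u ∈ T → (∀ a ∈ T, ∀ b ∈ S, b ∈ nb9 a → b ∈ T) → T = S) :
    S ∈ (walks (2 * (S.card - 1)) u).image List.toFinset := by
  have hpos : 0 < S.card := Finset.card_pos.2 ⟨u, hu⟩
  obtain ⟨l, hc, hl, hS, hcard⟩ := cover_aux S u hu conn (S.card - 1) (by omega)
  rw [Finset.mem_image]
  refine ⟨u :: l, ?_, Finset.eq_of_subset_of_card_le hS (by omega)⟩
  rw [← hl]; exact mem_walks l u hc

lemma antideriv (f : ℤ → ZMod 2) : ∃ F : ℤ → ZMod 2, F 0 = 0 ∧ ∀ n, F (n + 1) = F n + f n := by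
  refine ⟨fun n => ∑ i ∈ Finset.Ico 0 n, f i + ∑ i ∈ Finset.Ico n 0, f i, by simp, ?_⟩
  intro n
  have h2 : f n + f n = 0 := CharTwo.add_self_eq_zero _
  rcases le_or_gt 0 n with h | h
  · have e1 : Finset.Ico 0 (n + 1) = insert n (Finset.Ico 0 n) := by
      ext x; simp; omega
    have e2 : Finset.Ico (n + 1) 0 = ∅ := by ext x; simp; omega
    have e3 : Finset.Ico n 0 = ∅ := by ext x; simp; omega
    simp only [e1, e2, e3]
    rw [Finset.sum_insert (by simp)]
    simp [add_comm]
  · have e1 : Finset.Ico n 0 = insert n (Finset.Ico (n + 1) 0) := by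
      ext x; simp; omega
    have e2 : Finset.Ico 0 (n + 1) = ∅ := by ext x; simp; omega
    have e3 : Finset.Ico 0 n = ∅ := by ext x; simp; omega
    simp only [e1, e2, e3]
    rw [Finset.sum_insert (by simp)]
    linear_combination -h2

lemma potential (c : Site → Site → ZMod 2)
    (hc : ∀ x y : ℤ, c (x, y) (x + 1, y) + c (x + 1, y) (x + 1, y + 1)
      + c (x, y + 1) (x + 1, y + 1) + c (x, y) (x, y + 1) = 0) :
    ∃ g : Site → ZMod 2, (∀ x y, g (x + 1, y) = g (x, y) + c (x, y) (x + 1, y)) ∧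
      (∀ x y, g (x, y + 1) = g (x, y) + c (x, y) (x, y + 1)) := by
  obtain ⟨F, hF0, hF⟩ := antideriv fun x => c (x, 0) (x + 1, 0)
  choose G hG0 hG using fun x => antideriv fun y => c (x, y) (x, y + 1)
  have two : ∀ z : ZMod 2, z + z = 0 := CharTwo.add_self_eq_zero
  refine ⟨fun p => F p.1 + G p.1 p.2, ?_, ?_⟩
  · intro x y
    simp only
    have step : ∀ y, F (x + 1) + G (x + 1) y = F x + G x y + c (x, y) (x + 1, y) ↔
        F (x + 1) + G (x + 1) (y + 1) = F x + G x (y + 1) + c (x, y + 1) (x + 1, y + 1) := by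
      intro y
      have h := hc x y
      rw [hG, hG]
      constructor <;> intro h'
      · linear_combination h' + h - two (c (x, y + 1) (x + 1, y + 1)) -
          two (c (x, y) (x, y + 1)) - two (c (x, y) (x + 1, y)) + two (c (x, y) (x + 1, y))
      · linear_combination h' - h + two (c (x, y + 1) (x + 1, y + 1)) +
          two (c (x, y) (x, y + 1))
    induction y using Int.induction_on with
    | zero => rw [hG0, hG0, hF]; ring
    | succ n ih => exact (step n).1 ih
    | pred n ih =>
      apply (step _).2
      have : (-(n : ℤ) - 1 + 1) = -n := by ring
      rw [this]; exact ih
  · intro x y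
    simp only [hG]; ring

lemma mem_innerBdry {A : Finset Site} {v : Site} :
    v ∈ innerBdry A ↔ v ∈ A ∧ ∃ d ∈ dirs, v + d ∉ A := by
  simp [innerBdry]

lemma mem_dirs {d : Site} :
    d ∈ dirs ↔ d = (1, 0) ∨ d = (-1, 0) ∨ d = (0, 1) ∨ d = (0, -1) := by
  simp [dirs]

lemma inner_of_adj {A : Finset Site} {a b : Site} (ha : a ∈ A) (hb : b ∉ A)
    (h : b - a ∈ dirs) : a ∈ innerBdry A :=
  mem_innerBdry.2 ⟨ha, b - a, h, by simpa using hb⟩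

lemma plaq (α τ s : Fin 4 → Prop) (h1 : ∀ i, τ i → s i) (h2 : ∀ i, s i → α i)
    (h3 : ∀ i, α i → ¬ α (i + 1) → s i) (h4 : ∀ i, α (i + 1) → ¬ α i → s (i + 1))
    (h5 : ∀ i j, τ i → s j → τ j) :
    ((if (τ 0 ∧ ¬ α 1) ∨ (τ 1 ∧ ¬ α 0) then 1 else 0 : ZMod 2)
      + (if (τ 1 ∧ ¬ α 2) ∨ (τ 2 ∧ ¬ α 1) then 1 else 0)
      + (if (τ 3 ∧ ¬ α 2) ∨ (τ 2 ∧ ¬ α 3) then 1 else 0)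
      + (if (τ 0 ∧ ¬ α 3) ∨ (τ 3 ∧ ¬ α 0) then 1 else 0)) = 0 := by
  have two : (1 : ZMod 2) + 1 = 0 := by decide
  have k : ∀ i, τ i → ∀ j, τ j ↔ s j := fun i hi j => ⟨h1 j, h5 i j hi⟩
  by_cases hτ : ∃ i, τ i
  · obtain ⟨i, hi⟩ := hτ
    have e := k i hi
    have e1 : (0 : Fin 4) + 1 = 1 := rfl
    have e2 : (1 : Fin 4) + 1 = 2 := rfl
    have e3 : (2 : Fin 4) + 1 = 3 := rfl
    have e4 : (3 : Fin 4) + 1 = 0 := rfl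
    have up : ∀ i, (s i ∧ ¬ α (i + 1)) ↔ (α i ∧ ¬ α (i + 1)) := fun i =>
      ⟨fun h => ⟨h2 i h.1, h.2⟩, fun h => ⟨h3 i h.1 h.2, h.2⟩⟩
    have dn : ∀ i, (s (i + 1) ∧ ¬ α i) ↔ (α (i + 1) ∧ ¬ α i) := fun i =>
      ⟨fun h => ⟨h2 _ h.1, h.2⟩, fun h => ⟨h4 i h.1 h.2, h.2⟩⟩
    have u0 := up 0; have u1 := up 1; have u2 := up 2; have u3 := up 3
    have d0 := dn 0; have d1 := dn 1; have d2 := dn 2; have d3 := dn 3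
    rw [e1] at u0 d0; rw [e2] at u1 d1; rw [e3] at u2 d2; rw [e4] at u3 d3
    simp only [e, u0, u1, u2, u3, d0, d1, d2, d3]
    clear h1 h2 h3 h4 h5 k e up dn u0 u1 u2 u3 d0 d1 d2 d3
    by_cases A0 : α 0 <;> by_cases A1 : α 1 <;> by_cases A2 : α 2 <;> by_cases A3 : α 3 <;>
      simp [A0, A1, A2, A3, two]
  · push Not at hτ
    simp [hτ]

/-- The inner boundary of a simply connected set is `*`-connected. -/
lemma innerBdry_conn (A : Finset Site) (hA : connectedIn (↑A : Set Site))
    (hA' : connectedIn ((↑A : Set Site)ᶜ)) (u : Site)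
    (T : Finset Site) (hT : T ⊆ innerBdry A) (hu : u ∈ T)
    (hcl : ∀ a ∈ T, ∀ b ∈ innerBdry A, b ∈ nb9 a → b ∈ T) : T = innerBdry A := by
  refine Finset.Subset.antisymm hT fun v hv => ?_
  by_contra hvT
  have hTA : ∀ a ∈ T, a ∈ A := fun a ha => (mem_innerBdry.1 (hT ha)).1
  let c : Site → Site → ZMod 2 := fun a b =>
    if (a ∈ T ∧ ¬ b ∈ A) ∨ (b ∈ T ∧ ¬ a ∈ A) then 1 else 0
  have csymm : ∀ a b, c a b = c b a := by
    intro a b; simp only [c, or_comm]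
  obtain ⟨g, hg1, hg2⟩ := potential c (by
    intro x y
    let P : Fin 4 → Site := ![(x, y), (x + 1, y), (x + 1, y + 1), (x, y + 1)]
    have := plaq (fun i => P i ∈ A) (fun i => P i ∈ T) (fun i => P i ∈ innerBdry A)
      (fun i h => hT h) (fun i h => (mem_innerBdry.1 h).1)
      (by
        intro i h h'
        refine inner_of_adj h h' ?_
        fin_cases i <;> simp [P, mem_dirs])
      (by
        intro i h h'
        refine inner_of_adj h h' ?_
        fin_cases i <;> simp [P, mem_dirs])
      (by
        intro i j h h'
        refine hcl _ h _ h' ?_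
        rw [mem_nb9]
        fin_cases i <;> fin_cases j <;> simp [P] <;> omega)
    simp only [c]
    convert this <;> rfl)
  have two : ∀ z : ZMod 2, z + z = 0 := CharTwo.add_self_eq_zero
  have step : ∀ a b : Site, b - a ∈ dirs → g b = g a + c a b := by
    rintro ⟨x, y⟩ ⟨x', y'⟩ h
    simp only [mem_dirs, Prod.mk_sub_mk, Prod.mk.injEq] at h
    rcases h with h | h | h | h
    · obtain ⟨rfl, rfl⟩ : x' = x + 1 ∧ y' = y := by omega
      exact hg1 _ _
    · obtain ⟨rfl, rfl⟩ : x = x' + 1 ∧ y = y' := by omega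
      rw [hg1, csymm (x' + 1, y)]; linear_combination - two (c (x', y) (x' + 1, y))
    · obtain ⟨rfl, rfl⟩ : x' = x ∧ y' = y + 1 := by omega
      exact hg2 _ _
    · obtain ⟨rfl, rfl⟩ : x = x' ∧ y = y' + 1 := by omega
      rw [hg2, csymm (x, y' + 1)]; linear_combination - two (c (x, y') (x, y' + 1))
  have constA : ∀ a ∈ A, ∀ b ∈ A, g a = g b := by
    intro a ha b hb
    have := hA a (by simpa using ha) b (by simpa using hb)
    induction this with
    | refl => rfl
    | @tail p q _ h ih =>
      have h1 : p ∈ A := by simpa using h.2.1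
      have h2 : q ∈ A := by simpa using h.2.2
      rw [step _ _ h.1, ih h1]
      simp [c, h1, h2]
  have constB : ∀ a ∉ A, ∀ b ∉ A, g a = g b := by
    intro a ha b hb
    have := hA' a (by simpa using ha) b (by simpa using hb)
    induction this with
    | refl => rfl
    | @tail p q _ h ih =>
      have h1 : p ∉ A := by simpa using h.2.1
      have h2 : q ∉ A := by simpa using h.2.2
      rw [step _ _ h.1, ih h1]
      have h1' : p ∉ T := fun hh => h1 (hTA _ hh)
      have h2' : q ∉ T := fun hh => h2 (hTA _ hh)
      simp [c, h1', h2']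
  obtain ⟨huA, d, hd, hud⟩ := mem_innerBdry.1 (hT hu)
  obtain ⟨hvA, e, he, hve⟩ := mem_innerBdry.1 hv
  have e1 := step u (u + d) (by simpa using hd)
  have e2 := step v (v + e) (by simpa using he)
  have c1 : c u (u + d) = 1 := by simp [c, hu, hud]
  have c2 : c v (v + e) = 0 := by simp [c, hvT, hvA]
  rw [c1, constA u huA v hvA, constB _ hud _ hve, e2, c2] at e1
  simp at e1

lemma adjS_symm {a b : Site} (h : adjS a b) : adjS b a := by
  obtain ⟨x, y⟩ := a; obtain ⟨x', y'⟩ := b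
  simp only [adjS, mem_dirs, Prod.mk_sub_mk, Prod.mk.injEq] at *
  omega

lemma compl_sub_of_inner (A B : Finset Site) (h : innerBdry A = innerBdry B)
    (hA' : connectedIn ((↑A : Set Site)ᶜ)) : B ⊆ A := by
  intro x hxB
  by_contra hxA
  obtain ⟨p, hp⟩ := Infinite.exists_notMem_finset (A ∪ B)
  simp only [Finset.mem_union, not_or] at hp
  have := hA' p (by simpa using hp.1) x (by simpa using hxA)
  have key : x ∉ B := by
    clear hxB
    induction this with
    | refl => exact hp.2
    | @tail b c _ hbc ih =>
      have hb : b ∉ A := by simpa using hbc.2.1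
      have hc : c ∉ A := by simpa using hbc.2.2
      intro hcB
      have : c ∈ innerBdry B := inner_of_adj hcB (ih hb) (adjS_symm hbc.1)
      rw [← h] at this
      exact hc (mem_innerBdry.1 this).1
  exact key hxB

lemma exit_ray (A : Finset Site) (v d : Site) (hd : d ≠ 0) (hv : v ∈ A) :
    ∃ k : ℕ, (∀ j ≤ k, v + j • d ∈ A) ∧ v + (k + 1) • d ∉ A := by
  have hex : ∃ n : ℕ, v + n • d ∉ A := by
    by_contra hcon
    push Not at hcon
    have hinj : Function.Injective fun n : ℕ => v + n • d := by
      intro m n h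
      have h' : m • d = n • d := add_left_cancel h
      obtain ⟨x, y⟩ := d
      simp only [Prod.smul_mk, Prod.mk.injEq, nsmul_eq_mul] at h'
      by_cases hx : x = 0
      · have hy : y ≠ 0 := by rintro rfl; exact hd (by simp [hx])
        exact_mod_cast mul_right_cancel₀ hy h'.2
      · exact_mod_cast mul_right_cancel₀ hx h'.1
    exact Set.infinite_range_of_injective hinj
      ((A.finite_toSet).subset (by rintro _ ⟨n, rfl⟩; exact hcon n))
  have h0 : Nat.find hex ≠ 0 := by
    intro h
    have := Nat.find_spec hex
    rw [h] at this; simp [hv] at this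
  obtain ⟨k, hk⟩ := Nat.exists_eq_succ_of_ne_zero h0
  refine ⟨k, fun j hj => ?_, ?_⟩
  · by_contra hcon
    exact Nat.find_min hex (by omega : j < Nat.find hex) hcon
  · have := Nat.find_spec hex
    rw [hk] at this; exact this

lemma exists_start (A : Finset Site) (v : Site) (hv : v ∈ A) :
    ∃ k < (innerBdry A).card, v + k • ((1, 0) : Site) ∈ innerBdry A := by
  obtain ⟨k, hk, hk'⟩ := exit_ray A v (1, 0) (by simp) hv
  refine ⟨k, ?_, inner_of_adj (hk k le_rfl) hk' (by
    have : v + (k + 1) • ((1, 0) : Site) - (v + k • ((1, 0) : Site)) = (1, 0) := by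
      rw [succ_nsmul]; abel
    rw [this]; simp [mem_dirs])⟩
  have : ∀ j : ℕ, ∃ m : ℕ, j ≤ k →
      v + j • ((1, 0) : Site) + m • ((0, 1) : Site) ∈ innerBdry A := by
    intro j
    by_cases hj : j ≤ k
    · obtain ⟨m, hm, hm'⟩ := exit_ray A _ (0, 1) (by simp) (hk j hj)
      refine ⟨m, fun _ => inner_of_adj (hm m le_rfl) hm' (by
        have : ∀ w : Site, w + (m + 1) • ((0, 1) : Site) - (w + m • ((0, 1) : Site)) = (0, 1) := by
          intro w; rw [succ_nsmul]; abel
        rw [this]; simp [mem_dirs])⟩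
    · exact ⟨0, fun h => absurd h hj⟩
  choose m hm using this
  have hle : (Finset.range (k + 1)).card ≤ (innerBdry A).card := by
    refine Finset.card_le_card_of_injOn
      (fun j => v + j • ((1, 0) : Site) + m j • ((0, 1) : Site)) ?_ ?_
    · intro j hj
      simp only [Finset.coe_range, Set.mem_Iio] at hj
      exact hm j (by omega)
    · intro i _ j _ h
      have := congrArg Prod.fst h
      simpa using this
  simpa using hle

lemma innerBdry_card_le (A : Finset Site) : (innerBdry A).card ≤ edgeBdryCard A := by
  unfold edgeBdryCard innerBdry
  rw [Finset.card_filter]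
  refine Finset.sum_le_sum fun v _ => ?_
  split_ifs with h
  · obtain ⟨d, hd, hd'⟩ := h
    exact Finset.card_pos.2 ⟨d, by simp [hd, hd']⟩
  · exact Nat.zero_le _

lemma count_fiber (𝒜 : Finset (Finset Site)) (v : Site)
    (h𝒜 : ∀ A ∈ 𝒜, v ∈ A ∧ connectedIn (↑A : Set Site) ∧ connectedIn ((↑A : Set Site)ᶜ)) (m : ℕ) :
    (𝒜.filter fun A => (innerBdry A).card = m).card ≤ m * 81 ^ m := by
  have hsub : (𝒜.filter fun A => (innerBdry A).card = m).image innerBdry ⊆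
      (Finset.range m).biUnion fun k =>
        (walks (2 * (m - 1)) (v + k • ((1, 0) : Site))).image List.toFinset := by
    intro S hS
    simp only [Finset.mem_image, Finset.mem_filter] at hS
    obtain ⟨A, ⟨hA, hm⟩, rfl⟩ := hS
    obtain ⟨hv, h1, h2⟩ := h𝒜 A hA
    obtain ⟨k, hk, hk'⟩ := exists_start A v hv
    rw [Finset.mem_biUnion]
    refine ⟨k, by simpa [hm] using hk, ?_⟩
    have := cover (innerBdry A) _ hk' (fun T hT hu hcl => innerBdry_conn A h1 h2 _ T hT hu hcl)
    rw [hm] at this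
    exact this
  have hinj : Set.InjOn innerBdry (↑(𝒜.filter fun A => (innerBdry A).card = m) : Set (Finset Site)) := by
    intro A hA B hB h
    simp only [Finset.coe_filter, Set.mem_ofPred_eq] at hA hB
    exact Finset.Subset.antisymm (compl_sub_of_inner B A h.symm (h𝒜 B hB.1).2.2)
      (compl_sub_of_inner A B h (h𝒜 A hA.1).2.2)
  rw [← Finset.card_image_of_injOn hinj]
  refine (Finset.card_le_card hsub).trans (Finset.card_biUnion_le.trans ?_)
  calc _ ≤ ∑ k ∈ Finset.range m, 81 ^ m := by
        refine Finset.sum_le_sum fun k _ => Finset.card_image_le.trans ((walks_card _ _).trans ?_)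
        rw [show (81 : ℕ) = 9 ^ 2 from rfl, ← pow_mul]
        exact Nat.pow_le_pow_right (by norm_num) (by omega)
    _ = m * 81 ^ m := by simp

/-- Peierls bound. -/
lemma peierls (𝒜 : Finset (Finset Site)) (v : Site)
    (h𝒜 : ∀ A ∈ 𝒜, v ∈ A ∧ connectedIn (↑A : Set Site) ∧ connectedIn ((↑A : Set Site)ᶜ))
    (x : ℝ) (hx : 0 ≤ x) (hx' : 324 * x ≤ 1) :
    ∑ A ∈ 𝒜, x ^ edgeBdryCard A ≤ 324 * x := by
  have h1 : ∑ A ∈ 𝒜, x ^ edgeBdryCard A ≤ ∑ A ∈ 𝒜, x ^ (innerBdry A).card :=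
    Finset.sum_le_sum fun A _ => pow_le_pow_of_le_one hx (by linarith) (innerBdry_card_le A)
  refine h1.trans ?_
  let M := 𝒜.sup fun A => (innerBdry A).card
  have hmaps : ∀ A ∈ 𝒜, (innerBdry A).card ∈ Finset.Ico 1 (M + 1) := by
    intro A hA
    rw [Finset.mem_Ico]
    obtain ⟨k, hk, -⟩ := exists_start A v (h𝒜 A hA).1
    have : (innerBdry A).card ≤ M := Finset.le_sup (f := fun A => (innerBdry A).card) hA
    omega
  rw [← Finset.sum_fiberwise_of_maps_to hmaps]
  have h2 : ∀ m, ∑ A ∈ 𝒜 with (innerBdry A).card = m, x ^ (innerBdry A).card ≤ (162 * x) ^ m := by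
    intro m
    calc ∑ A ∈ 𝒜 with (innerBdry A).card = m, x ^ (innerBdry A).card
        = ∑ A ∈ 𝒜 with (innerBdry A).card = m, x ^ m :=
          Finset.sum_congr rfl fun A hA => by rw [(Finset.mem_filter.1 hA).2]
      _ = ((𝒜.filter fun A => (innerBdry A).card = m).card : ℝ) * x ^ m := by
          rw [Finset.sum_const, nsmul_eq_mul]
      _ ≤ (2 ^ m * 81 ^ m) * x ^ m := by
          gcongr
          have := count_fiber 𝒜 v h𝒜 m
          have h3 : m * 81 ^ m ≤ 2 ^ m * 81 ^ m :=
            Nat.mul_le_mul_right _ (Nat.lt_two_pow_self).le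
          exact_mod_cast this.trans h3
      _ = (162 * x) ^ m := by rw [← mul_pow, ← mul_pow]; norm_num
  refine (Finset.sum_le_sum fun m _ => h2 m).trans ?_
  set y := 162 * x with hy
  have hy0 : 0 ≤ y := by positivity
  have hy1 : y ≤ 1 / 2 := by linarith
  have : ∀ N : ℕ, ∑ m ∈ Finset.Ico 1 (N + 1), y ^ m ≤ 2 * y - 2 * y * (1 / 2) ^ N := by
    intro N
    induction N with
    | zero => simp
    | succ N ih =>
      rw [Finset.sum_Ico_succ_top (by omega)]
      have : y ^ (N + 1) ≤ y * (1 / 2) ^ N := by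
        rw [pow_succ, mul_comm]
        gcongr
      rw [pow_succ (1 / 2 : ℝ) N]
      linarith
  have h3 := this M
  have h4 : 0 ≤ 2 * y * (1 / 2) ^ M := by positivity
  linarith

end PeierlsPart
section SosPart

attribute [local instance] Classical.propDecidable

lemma abs_submod (a b c d : ℝ) :
    |min a c - min b d| + |max a c - max b d| ≤ |a - b| + |c - d| := by
  rcases le_total a c with h1 | h1 <;> rcases le_total b d with h2 | h2 <;>
    simp only [min_eq_left, min_eq_right, max_eq_left, max_eq_right, h1, h2]
  · exact le_rfl
  · rcases abs_cases (a - d) with h | h <;> rcases abs_cases (c - b) with h' | h' <;>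
      rcases abs_cases (a - b) with h'' | h'' <;> rcases abs_cases (c - d) with h''' | h''' <;>
      linarith
  · rcases abs_cases (a - d) with h | h <;> rcases abs_cases (c - b) with h' | h' <;>
      rcases abs_cases (a - b) with h'' | h'' <;> rcases abs_cases (c - d) with h''' | h''' <;>
      linarith
  · linarith

lemma energy_submod (V : Finset Site) (a b : Site → ℤ) :
    sosEnergy V (a ⊓ b) + sosEnergy V (a ⊔ b) ≤ sosEnergy V a + sosEnergy V b := by
  unfold sosEnergy
  rw [← Finset.sum_add_distrib, ← Finset.sum_add_distrib]
  refine Finset.sum_le_sum fun v _ => ?_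
  rw [← Finset.sum_add_distrib, ← Finset.sum_add_distrib]
  refine Finset.sum_le_sum fun d _ => ?_
  rw [← mul_add, ← mul_add]
  refine mul_le_mul_of_nonneg_left ?_ (by split_ifs <;> norm_num)
  simp only [Pi.inf_apply, Pi.sup_apply]
  push_cast
  exact abs_submod _ _ _ _

lemma energy_shift (V : Finset Site) (a : Site → ℤ) :
    sosEnergy V (fun x => a x + 1) = sosEnergy V a := by
  unfold sosEnergy
  refine Finset.sum_congr rfl fun v _ => Finset.sum_congr rfl fun d _ => ?_
  push_cast
  congr 2
  ring

lemma energy_nonneg (V : Finset Site) (a : Site → ℤ) : 0 ≤ sosEnergy V a := by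
  unfold sosEnergy
  refine Finset.sum_nonneg fun v _ => Finset.sum_nonneg fun d _ => ?_
  refine mul_nonneg (by split_ifs <;> norm_num) (abs_nonneg _)

lemma field_add (V : Finset Site) (a b : Site → ℤ) :
    sosField V (a ⊓ b) + sosField V (a ⊔ b) = sosField V a + sosField V b := by
  unfold sosField
  rw [← Finset.sum_add_distrib, ← Finset.sum_add_distrib]
  refine Finset.sum_congr rfl fun v _ => ?_
  simp only [Pi.inf_apply, Pi.sup_apply]
  push_cast
  exact min_add_max _ _

lemma field_mono (V : Finset Site) (a b : Site → ℤ) (h : a ≤ b) :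
    sosField V a ≤ sosField V b := by
  unfold sosField
  exact Finset.sum_le_sum fun v _ => by exact_mod_cast h v

lemma field_shift (V : Finset Site) (a : Site → ℤ) :
    sosField V (fun x => a x + 1) = sosField V a + V.card := by
  unfold sosField
  push_cast
  rw [Finset.sum_add_distrib]; simp

/-- The summand of `Zsos`. -/
noncomputable def Fs (β lam : ℝ) (η : Site → BSign) (h : ℤ) (V : Finset Site) : (Site → ℤ) → ℝ :=
  Set.indicator (signedConfigs V η h) (sosWt β lam V)

lemma Fs_nonneg (β lam : ℝ) (η : Site → BSign) (h : ℤ) (V : Finset Site) (ψ : Site → ℤ) :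
    0 ≤ Fs β lam η h V ψ :=
  Set.indicator_nonneg (fun _ _ => (Real.exp_pos _).le) _

lemma Fs_summable (β lam : ℝ) (hβ : 0 ≤ β) (hl : 0 < lam) (η : Site → BSign) (h : ℤ)
    (V : Finset Site) : Summable (Fs β lam η h V) := by
  set q := Real.exp (-lam) with hq
  have hq0 : 0 < q := Real.exp_pos _
  have hq1 : q < 1 := by rw [hq, Real.exp_lt_one_iff]; linarith
  refine summable_of_sum_le (c := ∏ _v : V, (1 - q)⁻¹) (Fs_nonneg β lam η h V) fun u => ?_
  let u' := u.filter fun ψ => ψ ∈ signedConfigs V η h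
  let N : ℕ := u.sup fun ψ => V.sup fun v => (ψ v).toNat + 1
  let m : (Site → ℤ) → (V → ℕ) := fun ψ v => (ψ v).toNat
  let G : (V → ℕ) → ℝ := fun p => ∏ v, q ^ p v
  have h1 : ∑ ψ ∈ u, Fs β lam η h V ψ = ∑ ψ ∈ u', Fs β lam η h V ψ := by
    rw [Finset.sum_filter]
    refine Finset.sum_congr rfl fun ψ _ => ?_
    split_ifs with hh
    · rfl
    · exact Set.indicator_of_notMem hh _
  have h2 : ∀ ψ ∈ u', Fs β lam η h V ψ ≤ G (m ψ) := by
    intro ψ hψ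
    have hc := (Finset.mem_filter.1 hψ).2
    rw [Fs, Set.indicator_of_mem hc, sosWt]
    have : G (m ψ) = Real.exp (-(lam * sosField V ψ)) := by
      simp only [G, m, hq, ← Real.exp_nat_mul]
      rw [← Real.exp_sum]
      congr 1
      rw [sosField, Finset.mul_sum, ← Finset.sum_neg_distrib, ← Finset.sum_coe_sort V]
      refine Finset.sum_congr rfl fun v _ => ?_
      have h0 : 0 ≤ ψ v := hc.2.1 v v.2
      have : ((ψ v).toNat : ℝ) = (ψ v : ℝ) := by
        have := Int.toNat_of_nonneg h0
        exact_mod_cast congrArg (Int.cast (R := ℝ)) this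
      rw [this]; ring
    rw [this]
    apply Real.exp_le_exp.2
    have := mul_nonneg hβ (energy_nonneg V ψ)
    linarith
  have hinj : Set.InjOn m (↑u' : Set (Site → ℤ)) := by
    intro a ha b hb hab
    have ha' := (Finset.mem_filter.1 (Finset.mem_coe.1 ha)).2
    have hb' := (Finset.mem_filter.1 (Finset.mem_coe.1 hb)).2
    funext x
    by_cases hx : x ∈ V
    · have := congrFun hab ⟨x, hx⟩
      simp only [m] at this
      have h0 := ha'.2.1 x hx
      have h0' := hb'.2.1 x hx
      omega
    · rw [ha'.1 x hx, hb'.1 x hx]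
  have h3 : u'.image m ⊆ Fintype.piFinset fun _ : V => Finset.range N := by
    intro p hp
    obtain ⟨ψ, hψ, rfl⟩ := Finset.mem_image.1 hp
    rw [Fintype.mem_piFinset]
    intro v
    rw [Finset.mem_range]
    have a1 : (ψ v).toNat + 1 ≤ V.sup fun v => (ψ v).toNat + 1 :=
      Finset.le_sup (f := fun v : Site => (ψ v).toNat + 1) v.2
    have a2 : (V.sup fun v => (ψ v).toNat + 1) ≤ N :=
      Finset.le_sup (f := fun ψ : Site → ℤ => V.sup fun v => (ψ v).toNat + 1)
        (Finset.mem_filter.1 hψ).1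
    simp only [m]; omega
  have hG : ∀ p, 0 ≤ G p := fun p => Finset.prod_nonneg fun v _ => by positivity
  calc ∑ ψ ∈ u, Fs β lam η h V ψ ≤ ∑ ψ ∈ u', G (m ψ) := by
        rw [h1]; exact Finset.sum_le_sum h2
    _ = ∑ p ∈ u'.image m, G p := by rw [Finset.sum_image hinj]
    _ ≤ ∑ p ∈ Fintype.piFinset fun _ : V => Finset.range N, G p :=
        Finset.sum_le_sum_of_subset_of_nonneg h3 fun p _ _ => hG p
    _ = ∏ _v : V, ∑ j ∈ Finset.range N, q ^ j := by
        rw [Finset.prod_univ_sum]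
    _ ≤ ∏ _v : V, (1 - q)⁻¹ := by
        refine Finset.prod_le_prod (fun _ _ => Finset.sum_nonneg fun _ _ => by positivity)
          fun _ _ => ?_
        rw [← tsum_geometric_of_lt_one hq0.le hq1]
        exact (summable_geometric_of_lt_one hq0.le hq1).sum_le_tsum _ fun _ _ => by positivity

lemma Zsos_eq (β lam : ℝ) (η : Site → BSign) (h : ℤ) (V : Finset Site) :
    Zsos β lam η h V = ∑' ψ, Fs β lam η h V ψ := rfl

lemma Zsos_nonneg (β lam : ℝ) (η : Site → BSign) (h : ℤ) (V : Finset Site) :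
    0 ≤ Zsos β lam η h V := tsum_nonneg (Fs_nonneg β lam η h V)

lemma Zsos_pos (β lam : ℝ) (hβ : 0 ≤ β) (hl : 0 < lam) (s : BSign) (h : ℤ) (hh : 0 ≤ h)
    (V : Finset Site) : 0 < Zsos β lam (constSign s) h V := by
  rw [Zsos_eq]
  refine (Fs_summable β lam hβ hl _ h V).tsum_pos (Fs_nonneg _ _ _ _ _) (fun _ => h) ?_
  rw [Fs, Set.indicator_of_mem]
  · exact Real.exp_pos _
  · refine ⟨fun _ _ => rfl, fun _ _ => hh, fun v _ => ?_⟩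
    cases s <;> simp [constSign, BSign.ok]

lemma four_tsum {α : Type*} [DistribLattice α] (f₁ f₂ f₃ f₄ : α → ℝ)
    (h₁ : 0 ≤ f₁) (h₂ : 0 ≤ f₂) (h₃ : 0 ≤ f₃) (h₄ : 0 ≤ f₄)
    (s₁ : Summable f₁) (s₂ : Summable f₂) (s₃ : Summable f₃) (s₄ : Summable f₄)
    (h : ∀ a b, f₁ a * f₂ b ≤ f₃ (a ⊓ b) * f₄ (a ⊔ b)) :
    (∑' a, f₁ a) * (∑' a, f₂ a) ≤ (∑' a, f₃ a) * (∑' a, f₄ a) := by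
  have ht : Tendsto (fun s : Finset α => (∑ a ∈ s, f₁ a) * (∑ a ∈ s, f₂ a)) atTop
      (nhds ((∑' a, f₁ a) * (∑' a, f₂ a))) := Tendsto.mul s₁.hasSum s₂.hasSum
  refine le_of_tendsto' ht fun s => ?_
  refine (four_functions_theorem f₁ f₂ f₃ f₄ h₁ h₂ h₃ h₄ h s s).trans ?_
  exact mul_le_mul (s₃.sum_le_tsum _ fun a _ => h₃ a) (s₄.sum_le_tsum _ fun a _ => h₄ a)
    (Finset.sum_nonneg fun a _ => h₄ a) (tsum_nonneg h₃)

lemma ratio_mono (β lam lam' : ℝ) (hβ : 0 ≤ β) (hl : 0 < lam) (hll : lam ≤ lam')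
    (η : Site → BSign) (h : ℤ) (V : Finset Site) :
    Zsos β lam' η (h + 1) V * Zsos β lam η h V ≤ Zsos β lam' η h V * Zsos β lam η (h + 1) V := by
  have hl' : 0 < lam' := hl.trans_le hll
  simp only [Zsos_eq]
  refine four_tsum _ _ _ _ (Fs_nonneg _ _ _ _ _) (Fs_nonneg _ _ _ _ _) (Fs_nonneg _ _ _ _ _)
    (Fs_nonneg _ _ _ _ _) (Fs_summable β _ hβ hl' _ _ _) (Fs_summable β _ hβ hl _ _ _)
    (Fs_summable β _ hβ hl' _ _ _) (Fs_summable β _ hβ hl _ _ _) fun a b => ?_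
  have hnn : 0 ≤ Fs β lam' η h V (a ⊓ b) * Fs β lam η (h + 1) V (a ⊔ b) :=
    mul_nonneg (Fs_nonneg _ _ _ _ _ _) (Fs_nonneg _ _ _ _ _ _)
  by_cases ha : a ∈ signedConfigs V η (h + 1)
  swap
  · rw [Fs, Set.indicator_of_notMem ha]; simpa using hnn
  by_cases hb : b ∈ signedConfigs V η h
  swap
  · rw [Fs.eq_1 β lam η h V, Set.indicator_of_notMem hb]; simpa using hnn
  have hinf : a ⊓ b ∈ signedConfigs V η h := by
    refine ⟨fun x hx => ?_, fun v hv => ?_, fun v hv => ?_⟩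
    · simp [ha.1 x hx, hb.1 x hx]
    · have := ha.2.1 v hv; have := hb.2.1 v hv; simp; omega
    · have h1 := ha.2.2 v hv
      have h2 := hb.2.2 v hv
      revert h1 h2
      cases η v <;> simp [BSign.ok] <;> omega
  have hsup : a ⊔ b ∈ signedConfigs V η (h + 1) := by
    refine ⟨fun x hx => ?_, fun v hv => ?_, fun v hv => ?_⟩
    · simp [ha.1 x hx, hb.1 x hx]
    · have := ha.2.1 v hv; have := hb.2.1 v hv; simp; omega
    · have h1 := ha.2.2 v hv
      have h2 := hb.2.2 v hv
      revert h1 h2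
      cases η v <;> simp [BSign.ok] <;> omega
  simp only [Fs, Set.indicator_of_mem ha, Set.indicator_of_mem hb, Set.indicator_of_mem hinf,
    Set.indicator_of_mem hsup, sosWt]
  rw [← Real.exp_add, ← Real.exp_add]
  apply Real.exp_le_exp.2
  have e1 := mul_le_mul_of_nonneg_left (energy_submod V a b) hβ
  have e2 := field_add V a b
  have e3 := mul_le_mul_of_nonneg_left (field_mono V (a ⊓ b) a inf_le_left) (sub_nonneg.2 hll)
  have e4 : lam * (sosField V (a ⊓ b) + sosField V (a ⊔ b)) =
    lam * (sosField V a + sosField V b) := by rw [e2]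
  nlinarith

lemma ratio_lower (β lam lam' : ℝ) (hβ : 0 ≤ β) (hl : 0 < lam) (hll : lam ≤ lam')
    (η : Site → BSign) (h : ℤ) (V : Finset Site) :
    Real.exp (-(V.card * (lam' - lam))) * Zsos β lam η (h + 1) V * Zsos β lam' η h V ≤
      Zsos β lam' η (h + 1) V * Zsos β lam η h V := by
  have hl' : 0 < lam' := hl.trans_le hll
  let e : (Site → ℤ) ≃ (Site → ℤ) := Equiv.addRight (fun _ => (1 : ℤ))
  have he : ∀ a, e a = fun x => a x + 1 := fun a => rfl
  have t1 : Zsos β lam η (h + 1) V = ∑' ψ, Fs β lam η (h + 1) V (e ψ) :=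
    (e.tsum_eq (Fs β lam η (h + 1) V)).symm
  have t2 : Zsos β lam' η (h + 1) V = ∑' ψ, Fs β lam' η (h + 1) V (e ψ) :=
    (e.tsum_eq (Fs β lam' η (h + 1) V)).symm
  have s1 : Summable fun ψ => Fs β lam η (h + 1) V (e ψ) :=
    (e.summable_iff (f := Fs β lam η (h + 1) V)).2 (Fs_summable β _ hβ hl _ _ _)
  have s2 : Summable fun ψ => Fs β lam' η (h + 1) V (e ψ) :=
    (e.summable_iff (f := Fs β lam' η (h + 1) V)).2 (Fs_summable β _ hβ hl' _ _ _)
  rw [t1, t2, Zsos_eq, Zsos_eq, ← s1.tsum_mul_left]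
  refine four_tsum _ _ _ _ (fun a => mul_nonneg (Real.exp_pos _).le (Fs_nonneg _ _ _ _ _ _))
    (Fs_nonneg _ _ _ _ _) (fun a => Fs_nonneg _ _ _ _ _ _)
    (Fs_nonneg _ _ _ _ _) (s1.mul_left _) (Fs_summable β _ hβ hl' _ _ _)
    s2 (Fs_summable β _ hβ hl _ _ _) fun a b => ?_
  have hnn : 0 ≤ Fs β lam' η (h + 1) V (e (a ⊓ b)) * Fs β lam η h V (a ⊔ b) :=
    mul_nonneg (Fs_nonneg _ _ _ _ _ _) (Fs_nonneg _ _ _ _ _ _)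
  by_cases ha : e a ∈ signedConfigs V η (h + 1)
  swap
  · rw [Fs, Set.indicator_of_notMem ha]; simpa using hnn
  by_cases hb : b ∈ signedConfigs V η h
  swap
  · rw [Fs.eq_1 β lam' η h V, Set.indicator_of_notMem hb]; simpa using hnn
  have ha1 : ∀ x, x ∉ V → a x + 1 = h + 1 := ha.1
  have ha2 : ∀ v ∈ V, 0 ≤ a v + 1 := ha.2.1
  have ha3 : ∀ v ∈ innerBdry V, BSign.ok (η v) (h + 1) (a v + 1) := ha.2.2
  have hinf : e (a ⊓ b) ∈ signedConfigs V η (h + 1) := by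
    rw [he]
    refine ⟨fun x hx => ?_, fun v hv => ?_, fun v hv => ?_⟩
    · have := ha1 x hx; have := hb.1 x hx; simp; omega
    · have := ha2 v hv; have := hb.2.1 v hv; simp; omega
    · have h1 := ha3 v hv
      have h2 := hb.2.2 v hv
      revert h1 h2
      cases η v <;> simp [BSign.ok] <;> omega
  have hsup : a ⊔ b ∈ signedConfigs V η h := by
    refine ⟨fun x hx => ?_, fun v hv => ?_, fun v hv => ?_⟩
    · have := ha1 x hx; have := hb.1 x hx; simp; omega
    · have := ha2 v hv; have := hb.2.1 v hv; simp; omega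
    · have h1 := ha3 v hv
      have h2 := hb.2.2 v hv
      revert h1 h2
      cases η v <;> simp [BSign.ok] <;> omega
  simp only [Fs, Set.indicator_of_mem ha, Set.indicator_of_mem hb, Set.indicator_of_mem hinf,
    Set.indicator_of_mem hsup, sosWt]
  rw [he, he, energy_shift, energy_shift, field_shift, field_shift]
  rw [← Real.exp_add, ← Real.exp_add, ← Real.exp_add]
  apply Real.exp_le_exp.2
  have e1 := mul_le_mul_of_nonneg_left (energy_submod V a b) hβ
  have e2 := field_add V a b
  have e3 := mul_le_mul_of_nonneg_left (field_mono V (a ⊓ b) b inf_le_right) (sub_nonneg.2 hll)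
  have e4 : lam * (sosField V (a ⊓ b) + sosField V (a ⊔ b)) =
    lam * (sosField V a + sosField V b) := by rw [e2]
  nlinarith

lemma Wrn_nonneg (β lam : ℝ) (h : ℤ) (γ : Contour) : 0 ≤ Wrn β lam h γ := by
  unfold Wrn
  split_ifs <;>
    exact mul_nonneg (Real.exp_pos _).le (div_nonneg (Zsos_nonneg _ _ _ _ _) (Zsos_nonneg _ _ _ _ _))

lemma Wtr_nonneg (β lam : ℝ) (h : ℤ) (γ : Contour) : 0 ≤ Wtr β lam h γ :=
  le_min (Wrn_nonneg _ _ _ _) (Real.exp_pos _).le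

lemma Wrn_lip (β lam lam' : ℝ) (hβ : 0 ≤ β) (hl : 0 < lam) (hll : lam ≤ lam') (h : ℕ)
    (γ : Contour) (hγ : h = 0 → γ.up = true) :
    Wrn β lam h γ ≤ Real.exp (γ.int.card * (lam' - lam)) * Wrn β lam' h γ ∧
    Wrn β lam' h γ ≤ Real.exp (γ.int.card * (lam' - lam)) * Wrn β lam h γ := by
  have hl' : 0 < lam' := hl.trans_le hll
  set E := Real.exp (γ.int.card * (lam' - lam)) with hE
  have hE1 : 1 ≤ E := by
    rw [hE, Real.one_le_exp_iff]
    exact mul_nonneg (Nat.cast_nonneg _) (sub_nonneg.2 hll)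
  have hEi : Real.exp (-(γ.int.card * (lam' - lam))) = E⁻¹ := by rw [Real.exp_neg]
  have gen : ∀ (s : BSign) (k : ℤ), 0 ≤ k → ∀ c : ℝ, 0 ≤ c →
      (c * (Zsos β lam (constSign s) (k + 1) γ.int / Zsos β lam (constSign s) k γ.int) ≤
        E * (c * (Zsos β lam' (constSign s) (k + 1) γ.int / Zsos β lam' (constSign s) k γ.int))) ∧
      (c * (Zsos β lam' (constSign s) (k + 1) γ.int / Zsos β lam' (constSign s) k γ.int) ≤
        c * (Zsos β lam (constSign s) (k + 1) γ.int / Zsos β lam (constSign s) k γ.int)) ∧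
      (c * (Zsos β lam (constSign s) k γ.int / Zsos β lam (constSign s) (k + 1) γ.int) ≤
        c * (Zsos β lam' (constSign s) k γ.int / Zsos β lam' (constSign s) (k + 1) γ.int)) ∧
      (c * (Zsos β lam' (constSign s) k γ.int / Zsos β lam' (constSign s) (k + 1) γ.int) ≤
        E * (c * (Zsos β lam (constSign s) k γ.int / Zsos β lam (constSign s) (k + 1) γ.int))) := by
    intro s k hk c hc
    have m1 := ratio_mono β lam lam' hβ hl hll (constSign s) k γ.int
    have m2 := ratio_lower β lam lam' hβ hl hll (constSign s) k γ.int
    rw [hEi] at m2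
    have p1 := Zsos_pos β lam hβ hl s k hk γ.int
    have p2 := Zsos_pos β lam hβ hl s (k + 1) (by omega) γ.int
    have p3 := Zsos_pos β lam' hβ hl' s k hk γ.int
    have p4 := Zsos_pos β lam' hβ hl' s (k + 1) (by omega) γ.int
    generalize Zsos β lam (constSign s) k γ.int = a at *
    generalize Zsos β lam (constSign s) (k + 1) γ.int = b at *
    generalize Zsos β lam' (constSign s) k γ.int = a' at *
    generalize Zsos β lam' (constSign s) (k + 1) γ.int = b' at *
    have hE0 : 0 < E := by linarith
    have m3 : b * a' ≤ E * (b' * a) := by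
      rw [mul_assoc] at m2
      rwa [inv_mul_le_iff₀ hE0] at m2
    have k1 : b / a ≤ E * (b' / a') := by
      rw [← mul_div_assoc, div_le_div_iff₀ p1 p3]; linarith
    have k2 : b' / a' ≤ b / a := by
      rw [div_le_div_iff₀ p3 p1]; linarith
    have k3 : a / b ≤ a' / b' := by
      rw [div_le_div_iff₀ p2 p4]; linarith
    have k4 : a' / b' ≤ E * (a / b) := by
      rw [← mul_div_assoc, div_le_div_iff₀ p4 p2]; linarith
    refine ⟨?_, mul_le_mul_of_nonneg_left k2 hc, mul_le_mul_of_nonneg_left k3 hc, ?_⟩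
    · calc _ ≤ c * (E * (b' / a')) := mul_le_mul_of_nonneg_left k1 hc
        _ = _ := by ring
    · calc _ ≤ c * (E * (a / b)) := mul_le_mul_of_nonneg_left k4 hc
        _ = _ := by ring
  have w1 := Wrn_nonneg β lam h γ
  have w2 := Wrn_nonneg β lam' h γ
  have b1 : Wrn β lam h γ ≤ E * Wrn β lam h γ := le_mul_of_one_le_left w1 hE1
  have b2 : Wrn β lam' h γ ≤ E * Wrn β lam' h γ := le_mul_of_one_le_left w2 hE1
  by_cases hup : γ.up = true
  · obtain ⟨g1, g2, -, -⟩ := gen .plus h (by positivity) (Real.exp (-β * (γ.len : ℝ)))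
      (Real.exp_pos _).le
    have e : ∀ l, Wrn β l h γ = Real.exp (-β * (γ.len : ℝ)) *
      (Zsos β l (constSign .plus) (h + 1) γ.int / Zsos β l (constSign .plus) h γ.int) := by
      intro l; rw [Wrn, if_pos hup]
    rw [← e, ← e] at g1 g2
    exact ⟨g1, g2.trans b1⟩
  · have hh : (0 : ℤ) ≤ (h : ℤ) - 1 := by
      have : h ≠ 0 := fun h0 => hup (hγ h0)
      omega
    obtain ⟨-, -, g1, g2⟩ := gen .minus (h - 1) hh (Real.exp (-β * (γ.len : ℝ)))
      (Real.exp_pos _).le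
    have e : ∀ l, Wrn β l h γ = Real.exp (-β * (γ.len : ℝ)) *
      (Zsos β l (constSign .minus) (h - 1) γ.int / Zsos β l (constSign .minus) h γ.int) := by
      intro l; rw [Wrn, if_neg hup]
    rw [sub_add_cancel, ← e, ← e] at g1 g2
    exact ⟨g1.trans b2, g2⟩

lemma min_lip (a b c t : ℝ) (ht : 0 ≤ t) (ha : 0 ≤ a) (hb : 0 ≤ b) (hc : 0 ≤ c)
    (h : a ≤ Real.exp t * b) :
    min a c ≤ min b c + t * c := by
  have h1 : 1 ≤ Real.exp t := Real.one_le_exp ht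
  have h2 : min a c ≤ Real.exp t * min b c := by
    rw [mul_min_of_nonneg _ _ (by positivity)]
    exact min_le_min h (le_mul_of_one_le_left hc h1)
  have h3 : Real.exp (-t) * min a c ≤ min b c := by
    rw [Real.exp_neg, inv_mul_le_iff₀ (Real.exp_pos t)]; exact h2
  have h4 : 1 - t ≤ Real.exp (-t) := by have := Real.add_one_le_exp (-t); linarith
  have h5 : 0 ≤ min a c := le_min ha hc
  have h6 : min a c ≤ c := min_le_right _ _
  nlinarith [mul_le_mul_of_nonneg_right h4 h5, mul_le_mul_of_nonneg_left h6 ht]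

lemma Wtr_lip (β lam lam' : ℝ) (hβ : 0 ≤ β) (hl : 0 < lam) (hl' : 0 < lam') (h : ℕ)
    (γ : Contour) (hγ : h = 0 → γ.up = true) :
    Wtr β lam' h γ ≤ Wtr β lam h γ +
      γ.int.card * |lam' - lam| * Real.exp (-(β - 5) * (γ.len : ℝ)) := by
  refine min_lip _ _ _ _ (by positivity) (Wrn_nonneg _ _ _ _) (Wrn_nonneg _ _ _ _)
    (Real.exp_pos _).le ?_
  rcases le_total lam lam' with hle | hle
  · rw [abs_of_nonneg (sub_nonneg.2 hle)]
    exact (Wrn_lip β lam lam' hβ hl hle h γ hγ).2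
  · rw [abs_of_nonpos (sub_nonpos.2 hle), neg_sub]
    exact (Wrn_lip β lam' lam hβ hl' hle h γ hγ).1

end SosPart
section GasPart

attribute [local instance] Classical.propDecidable

lemma hasSum_support {α : Type*} (w : α → ℝ) (S : Finset α) :
    (∀ a ∈ S, 0 ≤ w a ∧ w a < 1) →
    HasSum (fun Γ : {Γ : Multiset α // Γ.toFinset = S} => (Γ.1.map w).prod)
      (∏ a ∈ S, w a / (1 - w a)) := by
  induction S using Finset.induction_on with
  | empty =>
    intro _
    have : Unique {Γ : Multiset α // Γ.toFinset = ∅} :=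
      { default := ⟨0, by simp⟩
        uniq := fun Γ => Subtype.ext (Multiset.toFinset_eq_empty.1 Γ.2) }
    convert hasSum_unique _
    have hd : ((default : {Γ : Multiset α // Γ.toFinset = ∅})).1 = 0 :=
      Multiset.toFinset_eq_empty.1 (default : {Γ : Multiset α // Γ.toFinset = ∅}).2
    rw [hd]; simp
  | insert a S ha ih =>
    intro hw
    have hS := ih fun b hb => hw b (Finset.mem_insert_of_mem hb)
    obtain ⟨hw0, hw1⟩ := hw a (Finset.mem_insert_self _ _)
    have hgeo : HasSum (fun n : ℕ => w a ^ (n + 1)) (w a / (1 - w a)) := by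
      have := (hasSum_geometric_of_lt_one hw0 hw1).mul_left (w a)
      simpa [pow_succ, mul_comm, div_eq_mul_inv] using this
    have hnn : ∀ Γ : {Γ : Multiset α // Γ.toFinset = S}, 0 ≤ (Γ.1.map w).prod := by
      intro Γ
      refine Multiset.prod_nonneg fun x hx => ?_
      obtain ⟨b, hb, rfl⟩ := Multiset.mem_map.1 hx
      exact (hw b (Finset.mem_insert_of_mem (by rw [← Γ.2]; simpa using hb))).1
    have hprod := hgeo.mul hS (hgeo.summable.mul_of_nonneg hS.summable
      (fun n => pow_nonneg hw0 _) hnn)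
    rw [Finset.prod_insert ha]
    let i : ℕ × {Γ : Multiset α // Γ.toFinset = S} →
        {Γ : Multiset α // Γ.toFinset = insert a S} := fun p =>
      ⟨Multiset.replicate (p.1 + 1) a + p.2.1, by
        ext x
        rw [Multiset.toFinset_add, p.2.2, Finset.mem_union, Multiset.mem_toFinset,
          Multiset.mem_replicate, Finset.mem_insert]
        simp⟩
    have hna : ∀ Γ : {Γ : Multiset α // Γ.toFinset = S}, Γ.1.count a = 0 := by
      intro Γ
      rw [Multiset.count_eq_zero]
      intro h; apply ha; rw [← Γ.2]; simpa using h
    have hbij : Function.Bijective i := by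
      constructor
      · rintro ⟨m, Γ⟩ ⟨n, Δ⟩ hh
        have hv : Multiset.replicate (m + 1) a + Γ.1 = Multiset.replicate (n + 1) a + Δ.1 :=
          congrArg Subtype.val hh
        have hcount := congrArg (Multiset.count a) hv
        simp only [Multiset.count_add, hna, Multiset.count_replicate_self] at hcount
        obtain rfl : m = n := by omega
        have : Γ = Δ := Subtype.ext (add_left_cancel hv)
        rw [this]
      · rintro ⟨Δ, hΔ⟩
        have haΔ : a ∈ Δ := by rw [← Multiset.mem_toFinset, hΔ]; simp
        have hc : 1 ≤ Δ.count a := Multiset.one_le_count_iff_mem.2 haΔ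
        refine ⟨(Δ.count a - 1, ⟨Δ.filter (fun x => x ≠ a), ?_⟩), Subtype.ext ?_⟩
        · ext x
          have := congrArg (fun s => x ∈ s) hΔ
          simp only [Multiset.mem_toFinset, Finset.mem_insert, eq_iff_iff] at this
          simp only [Multiset.mem_toFinset, Multiset.mem_filter, this]
          constructor
          · rintro ⟨h1 | h1, h2⟩
            · exact absurd h1 h2
            · exact h1
          · intro h1
            exact ⟨Or.inr h1, fun h2 => ha (h2 ▸ h1)⟩
        · simp only [i]
          rw [Nat.sub_add_cancel hc]
          ext x
          rw [Multiset.count_add, Multiset.count_replicate, Multiset.count_filter]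
          by_cases hx : x = a
          · subst hx; simp
          · simp [hx, Ne.symm hx]
    rw [← (Equiv.ofBijective i hbij).hasSum_iff]
    have hfun : ((fun Γ : {Γ : Multiset α // Γ.toFinset = insert a S} => (Γ.1.map w).prod) ∘
        ⇑(Equiv.ofBijective i hbij)) = fun p => w a ^ (p.1 + 1) * (p.2.1.map w).prod := by
      funext p
      simp only [Function.comp, Equiv.ofBijective_apply]
      simp only [i, Multiset.map_add, Multiset.prod_add, Multiset.map_replicate,
        Multiset.prod_replicate]
    rw [hfun]
    exact hprod

lemma tsum_families {α : Type*} (w : α → ℝ) (𝒮 : Finset (Finset α))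
    (hw : ∀ S ∈ 𝒮, ∀ a ∈ S, 0 ≤ w a ∧ w a < 1) :
    ∑' Γ : Multiset α, Set.indicator {Γ | Γ.toFinset ∈ 𝒮} (fun Γ => (Γ.map w).prod) Γ =
      ∑ S ∈ 𝒮, ∏ a ∈ S, w a / (1 - w a) := by
  have h1 : ∀ S ∈ 𝒮, HasSum (Set.indicator {Γ : Multiset α | Γ.toFinset = S}
      (fun Γ => (Γ.map w).prod)) (∏ a ∈ S, w a / (1 - w a)) := by
    intro S hS
    rw [← hasSum_subtype_iff_indicator]
    exact hasSum_support w S (hw S hS)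
  have h2 := hasSum_sum h1
  rw [← h2.tsum_eq]
  congr 1
  funext Γ
  by_cases h : Γ.toFinset ∈ 𝒮
  · rw [Set.indicator_of_mem (by exact h), Finset.sum_eq_single Γ.toFinset]
    · rw [Set.indicator_of_mem (by simp)]
    · intro S _ hne
      exact Set.indicator_of_notMem (fun hh => hne hh.symm) _
    · intro hh; exact absurd h hh
  · rw [Set.indicator_of_notMem (by exact h), Finset.sum_eq_zero]
    intro S hS
    exact Set.indicator_of_notMem (fun hh => h (by rw [show Γ.toFinset = S from hh]; exact hS)) _

lemma gas_bound {α : Type*} (C : Finset α) (𝒮 : Finset (Finset α))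
    (hC : ∀ S ∈ 𝒮, S ⊆ C) (hdown : ∀ S ∈ 𝒮, ∀ T ⊆ S, T ∈ 𝒮) (y y' δ : α → ℝ)
    (hy : ∀ a ∈ C, 0 ≤ y a) (hy' : ∀ a ∈ C, 0 ≤ y' a) (hδ : ∀ a ∈ C, 0 ≤ δ a)
    (h : ∀ a ∈ C, y' a ≤ y a + δ a) :
    ∑ S ∈ 𝒮, ∏ a ∈ S, y' a ≤ (∑ S ∈ 𝒮, ∏ a ∈ S, y a) * Real.exp (∑ a ∈ C, δ a) := by
  have h1 : ∑ S ∈ 𝒮, ∏ a ∈ S, y' a ≤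
      ∑ S ∈ 𝒮, ∑ T ∈ S.powerset, (∏ a ∈ T, y a) * ∏ a ∈ S \ T, δ a := by
    refine Finset.sum_le_sum fun S hS => ?_
    rw [← Finset.prod_add]
    exact Finset.prod_le_prod (fun a ha => hy' a (hC S hS ha)) fun a ha => h a (hC S hS ha)
  have h2 : ∑ S ∈ 𝒮, ∑ T ∈ S.powerset, (∏ a ∈ T, y a) * ∏ a ∈ S \ T, δ a ≤
      ∑ p ∈ 𝒮 ×ˢ C.powerset, (∏ a ∈ p.1, y a) * ∏ a ∈ p.2, δ a := by
    rw [Finset.sum_sigma']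
    let f : (Σ _ : Finset α, Finset α) → Finset α × Finset α := fun q => (q.2, q.1 \ q.2)
    have hinj : Set.InjOn f (↑(𝒮.sigma fun S => S.powerset) : Set (Σ _ : Finset α, Finset α)) := by
      rintro ⟨S, T⟩ hq ⟨S', T'⟩ hq' hf
      simp only [Finset.coe_sigma, Set.mem_sigma_iff, Finset.mem_coe, Finset.mem_powerset] at hq hq'
      simp only [f, Prod.mk.injEq] at hf
      obtain ⟨rfl, hf⟩ := hf
      have : S = S' := by
        rw [← Finset.union_sdiff_of_subset hq.2, hf, Finset.union_sdiff_of_subset hq'.2]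
      subst this; rfl
    have := Finset.sum_image (f := fun p : Finset α × Finset α =>
      (∏ a ∈ p.1, y a) * ∏ a ∈ p.2, δ a) hinj
    rw [← this]
    refine Finset.sum_le_sum_of_subset_of_nonneg ?_ ?_
    · intro p hp
      obtain ⟨⟨S, T⟩, hq, rfl⟩ := Finset.mem_image.1 hp
      simp only [Finset.mem_sigma, Finset.mem_powerset] at hq
      simp only [f, Finset.mem_product, Finset.mem_powerset]
      exact ⟨hdown S hq.1 T hq.2, Finset.sdiff_subset.trans (hC S hq.1)⟩
    · intro p hp _
      simp only [Finset.mem_product, Finset.mem_powerset] at hp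
      exact mul_nonneg (Finset.prod_nonneg fun a ha => hy a (hC _ hp.1 ha))
        (Finset.prod_nonneg fun a ha => hδ a (hp.2 ha))
  refine h1.trans (h2.trans ?_)
  rw [Finset.sum_product]
  dsimp only
  rw [← Finset.sum_mul_sum]
  refine mul_le_mul_of_nonneg_left ?_ (Finset.sum_nonneg fun S hS =>
    Finset.prod_nonneg fun a ha => hy a (hC S hS ha))
  rw [← Finset.prod_one_add, Real.exp_sum]
  refine Finset.prod_le_prod (fun a ha => by have := hδ a ha; linarith) fun a _ => ?_
  have := Real.add_one_le_exp (δ a); linarith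

end GasPart

section FinalPart

attribute [local instance] Classical.propDecidable

/-- The contours available in `U` at height `h`. -/
noncomputable def cC (h : ℕ) (U : Finset Site) : Finset Contour :=
  ((U.powerset ×ˢ (Finset.univ : Finset Bool)).image
    (fun p : Finset Site × Bool => Contour.mk p.1 p.2)).filter
    (fun γ => γ.valid ∧ (h = 0 → γ.up = true))

lemma mem_cC {h : ℕ} {U : Finset Site} {γ : Contour} :
    γ ∈ cC h U ↔ γ.int ⊆ U ∧ γ.valid ∧ (h = 0 → γ.up = true) := by
  unfold cC
  rw [Finset.mem_filter, Finset.mem_image]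
  constructor
  · rintro ⟨⟨p, hp, rfl⟩, h2⟩
    exact ⟨by simpa using hp, h2⟩
  · rintro ⟨h1, h2⟩
    exact ⟨⟨(γ.int, γ.up), by simpa using h1, rfl⟩, h2⟩

/-- Supports of admissible families with free boundary signing. -/
noncomputable def cS (h : ℕ) (U : Finset Site) : Finset (Finset Contour) :=
  (cC h U).powerset.filter (fun S => famOK (constSign .free) (h : ℤ) U S.val)

lemma famOK_mono {η : Site → BSign} {h : ℤ} {U : Finset Site} {Γ Δ : Multiset Contour}
    (hs : ∀ γ ∈ Δ, γ ∈ Γ) (hΓ : famOK η h U Γ) : famOK η h U Δ := by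
  obtain ⟨h1, h2, h3, h4⟩ := hΓ
  exact ⟨fun γ hγ => h1 γ (hs γ hγ), fun γ hγ γ' hγ' => h2 γ (hs γ hγ) γ' (hs γ' hγ'),
    fun v hv γ hγ => h3 v hv γ (hs γ hγ), fun hh γ hγ => h4 hh γ (hs γ hγ)⟩

lemma famOK_iff (h : ℕ) (U : Finset Site) (Γ : Multiset Contour) :
    famOK (constSign .free) (h : ℤ) U Γ ↔ Γ.toFinset ∈ cS h U := by
  unfold cS
  rw [Finset.mem_filter, Finset.mem_powerset]
  constructor
  · intro hΓ
    refine ⟨fun γ hγ => ?_, famOK_mono (fun γ hγ => ?_) hΓ⟩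
    · have hγ' : γ ∈ Γ := by simpa using hγ
      exact mem_cC.2 ⟨(hΓ.1 γ hγ').2, (hΓ.1 γ hγ').1, fun hh => hΓ.2.2.2 (by simp [hh]) γ hγ'⟩
    · simpa using hγ
  · rintro ⟨_, h2⟩
    exact famOK_mono (fun γ hγ => by simpa using hγ) h2

lemma cS_sub (h : ℕ) (U : Finset Site) : ∀ S ∈ cS h U, S ⊆ cC h U := by
  intro S hS
  exact Finset.mem_powerset.1 (Finset.mem_filter.1 hS).1

lemma cS_down (h : ℕ) (U : Finset Site) : ∀ S ∈ cS h U, ∀ T ⊆ S, T ∈ cS h U := by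
  intro S hS T hT
  unfold cS at hS ⊢
  rw [Finset.mem_filter, Finset.mem_powerset] at hS ⊢
  exact ⟨hT.trans hS.1, famOK_mono (fun γ hγ => hT hγ) hS.2⟩

lemma cS_empty (h : ℕ) (U : Finset Site) : (∅ : Finset Contour) ∈ cS h U := by
  unfold cS
  rw [Finset.mem_filter]
  refine ⟨by simp, ?_⟩
  simp [famOK]

lemma len_pos {γ : Contour} (hγ : γ.valid) : 1 ≤ γ.len := by
  obtain ⟨v, hv⟩ := hγ.1
  obtain ⟨k, hk, _⟩ := exists_start γ.int v hv
  have := innerBdry_card_le γ.int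
  unfold Contour.len
  omega

lemma exp_len (β : ℝ) (γ : Contour) :
    Real.exp (-(β - 5) * (γ.len : ℝ)) = Real.exp (-(β - 5)) ^ γ.len := by
  rw [mul_comm, Real.exp_nat_mul]

lemma sum_int (h : ℕ) (U : Finset Site) (x : ℝ) (hx : 0 ≤ x) (hx' : 324 * x ≤ 1) :
    ∑ γ ∈ cC h U, (γ.int.card : ℝ) * x ^ γ.len ≤ 648 * x * U.card := by
  have e1 : ∀ γ ∈ cC h U, (γ.int.card : ℝ) * x ^ γ.len =
      ∑ v ∈ U, if v ∈ γ.int then x ^ γ.len else 0 := by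
    intro γ hγ
    rw [← Finset.sum_filter, Finset.sum_const, nsmul_eq_mul]
    congr 3
    ext v
    rw [Finset.mem_filter]
    exact ⟨fun hv => ⟨(mem_cC.1 hγ).1 hv, hv⟩, fun hv => hv.2⟩
  rw [Finset.sum_congr rfl e1, Finset.sum_comm]
  have e2 : ∀ v ∈ U, ∑ γ ∈ cC h U, (if v ∈ γ.int then x ^ γ.len else 0) ≤ 648 * x := by
    intro v _
    rw [← Finset.sum_filter]
    let 𝒜 : Finset (Finset Site) := U.powerset.filter fun A =>
      v ∈ A ∧ connectedIn (↑A : Set Site) ∧ connectedIn ((↑A : Set Site)ᶜ)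
    have hp : ∑ A ∈ 𝒜, x ^ edgeBdryCard A ≤ 324 * x :=
      peierls 𝒜 v (fun A hA => (Finset.mem_filter.1 hA).2) x hx hx'
    let f : Contour → Finset Site × Bool := fun γ => (γ.int, γ.up)
    have hinj : Set.InjOn f (↑((cC h U).filter fun γ => v ∈ γ.int) : Set Contour) := by
      rintro ⟨a, b⟩ _ ⟨c, d⟩ _ hh
      simp only [f, Prod.mk.injEq] at hh
      obtain ⟨rfl, rfl⟩ := hh
      rfl
    have e3 := Finset.sum_image (f := fun p : Finset Site × Bool => x ^ edgeBdryCard p.1) hinj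
    have e4 : ∑ γ ∈ (cC h U).filter (fun γ => v ∈ γ.int), x ^ γ.len ≤
        ∑ p ∈ 𝒜 ×ˢ (Finset.univ : Finset Bool), x ^ edgeBdryCard p.1 := by
      refine le_trans (le_of_eq e3.symm) ?_
      refine Finset.sum_le_sum_of_subset_of_nonneg ?_ fun _ _ _ => pow_nonneg hx _
      intro p hp
      obtain ⟨γ, hγ, rfl⟩ := Finset.mem_image.1 hp
      obtain ⟨hγ1, hγ2⟩ := Finset.mem_filter.1 hγ
      obtain ⟨g1, g2, _⟩ := mem_cC.1 hγ1
      rw [Finset.mem_product]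
      refine ⟨Finset.mem_filter.2 ⟨Finset.mem_powerset.2 g1, hγ2, g2.2⟩, Finset.mem_univ _⟩
    refine e4.trans ?_
    rw [Finset.sum_product]
    simp only [Finset.sum_const, Finset.card_univ, Fintype.card_bool, nsmul_eq_mul]
    rw [← Finset.mul_sum]
    push_cast
    linarith
  refine (Finset.sum_le_sum e2).trans ?_
  rw [Finset.sum_const, nsmul_eq_mul]
  linarith

/-- The gas partition function. -/
noncomputable def Xi (β lam : ℝ) (h : ℕ) (U : Finset Site) : ℝ :=
  ∑ S ∈ cS h U, ∏ γ ∈ S, Wtr β lam h γ / (1 - Wtr β lam h γ)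

lemma Wtr_le (β lam : ℝ) (h : ℤ) (γ : Contour) (hγ : γ.valid)
    (hx : 324 * Real.exp (-(β - 5)) ≤ 1) :
    Wtr β lam h γ ≤ Real.exp (-(β - 5)) ^ γ.len ∧ Wtr β lam h γ ≤ 1 / 2 := by
  have h1 : Wtr β lam h γ ≤ Real.exp (-(β - 5)) ^ γ.len := by
    rw [← exp_len]; exact min_le_right _ _
  refine ⟨h1, h1.trans ?_⟩
  have hx0 := (Real.exp_pos (-(β - 5))).le
  have : Real.exp (-(β - 5)) ^ γ.len ≤ Real.exp (-(β - 5)) ^ 1 :=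
    pow_le_pow_of_le_one hx0 (by linarith) (len_pos hγ)
  rw [pow_one] at this
  linarith

lemma Ztr_eq (β lam : ℝ) (h : ℕ) (U : Finset Site) (hx : 324 * Real.exp (-(β - 5)) ≤ 1) :
    Ztr β lam (constSign .free) (h : ℤ) U =
      Real.exp (-lam * (h : ℝ) * (U.card : ℝ)) * Xi β lam h U := by
  unfold Ztr Xi
  rw [← tsum_families]
  · have : {Γ | famOK (constSign .free) (h : ℤ) U Γ} = {Γ | Γ.toFinset ∈ cS h U} := by
      ext Γ; exact famOK_iff h U Γ
    rw [this]
    simp only [Int.cast_natCast]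
    rfl
  · intro S hS γ hγ
    have := (mem_cC.1 (cS_sub h U S hS hγ)).2.1
    exact ⟨Wtr_nonneg _ _ _ _, lt_of_le_of_lt (Wtr_le β lam h γ this hx).2 (by norm_num)⟩

lemma y_nonneg (β lam : ℝ) (h : ℕ) (U : Finset Site) (hx : 324 * Real.exp (-(β - 5)) ≤ 1) :
    ∀ γ ∈ cC h U, 0 ≤ Wtr β lam h γ / (1 - Wtr β lam h γ) := by
  intro γ hγ
  have := (Wtr_le β lam h γ (mem_cC.1 hγ).2.1 hx).2
  exact div_nonneg (Wtr_nonneg _ _ _ _) (by linarith)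

lemma Xi_ge (β lam : ℝ) (h : ℕ) (U : Finset Site) (hx : 324 * Real.exp (-(β - 5)) ≤ 1) :
    1 ≤ Xi β lam h U := by
  unfold Xi
  have := Finset.single_le_sum (f := fun S => ∏ γ ∈ S, Wtr β lam h γ / (1 - Wtr β lam h γ))
    (s := cS h U) (fun S hS => Finset.prod_nonneg fun γ hγ =>
      y_nonneg β lam h U hx γ (cS_sub h U S hS hγ)) (cS_empty h U)
  simpa using this

lemma y_lip (w w' d : ℝ) (h0 : w ≤ 1 / 2) (h0' : w' ≤ 1 / 2) (hd : 0 ≤ d)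
    (h : w' ≤ w + d) : w' / (1 - w') ≤ w / (1 - w) + 4 * d := by
  have p : 0 < 1 - w := by linarith
  have p' : 0 < 1 - w' := by linarith
  rw [div_add' _ _ _ p.ne', div_le_div_iff₀ p' p]
  have q : 1 / 4 ≤ (1 - w) * (1 - w') := by nlinarith
  nlinarith [mul_le_mul_of_nonneg_left q hd]

lemma Xi_lip (β lam lam' : ℝ) (hβ : 0 ≤ β) (hl : 0 < lam) (hl' : 0 < lam') (h : ℕ)
    (U : Finset Site) (hx : 324 * Real.exp (-(β - 5)) ≤ 1) :
    Xi β lam' h U ≤ Xi β lam h U *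
      Real.exp (2592 * Real.exp (-(β - 5)) * |lam' - lam| * U.card) := by
  have hg := gas_bound (cC h U) (cS h U) (cS_sub h U) (cS_down h U)
    (fun γ => Wtr β lam h γ / (1 - Wtr β lam h γ))
    (fun γ => Wtr β lam' h γ / (1 - Wtr β lam' h γ))
    (fun γ => 4 * (γ.int.card * |lam' - lam| * Real.exp (-(β - 5)) ^ γ.len))
    (y_nonneg β lam h U hx) (y_nonneg β lam' h U hx)
    (fun γ _ => by positivity)
    (fun γ hγ => by
      have hv := mem_cC.1 hγ
      refine y_lip _ _ _ (Wtr_le β lam h γ hv.2.1 hx).2 (Wtr_le β lam' h γ hv.2.1 hx).2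
        (by positivity) ?_
      rw [← exp_len]
      exact Wtr_lip β lam lam' hβ hl hl' h γ hv.2.2)
  refine hg.trans ?_
  have hXi := Xi_ge β lam h U hx
  refine mul_le_mul_of_nonneg_left (Real.exp_le_exp.2 ?_) (by unfold Xi at hXi; linarith)
  have hs := sum_int h U (Real.exp (-(β - 5))) (Real.exp_pos _).le hx
  have e : ∑ γ ∈ cC h U, 4 * (γ.int.card * |lam' - lam| * Real.exp (-(β - 5)) ^ γ.len) =
      4 * |lam' - lam| * ∑ γ ∈ cC h U, (γ.int.card : ℝ) * Real.exp (-(β - 5)) ^ γ.len := by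
    rw [Finset.mul_sum]
    exact Finset.sum_congr rfl fun γ _ => by ring
  rw [e]
  have := mul_le_mul_of_nonneg_left hs (by positivity : 0 ≤ 4 * |lam' - lam|)
  linarith

lemma Xi_le (β lam : ℝ) (h : ℕ) (U : Finset Site) (hx : 324 * Real.exp (-(β - 5)) ≤ 1) :
    Xi β lam h U ≤ Real.exp (1296 * Real.exp (-(β - 5)) * U.card) := by
  have hg := gas_bound (cC h U) (cS h U) (cS_sub h U) (cS_down h U)
    (fun _ => 0)
    (fun γ => Wtr β lam h γ / (1 - Wtr β lam h γ))
    (fun γ => 2 * (γ.int.card * Real.exp (-(β - 5)) ^ γ.len))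
    (fun _ _ => le_rfl) (y_nonneg β lam h U hx)
    (fun γ _ => by positivity)
    (fun γ hγ => by
      have hv := mem_cC.1 hγ
      have h1 := Wtr_le β lam h γ hv.2.1 hx
      have h2 : (1 : ℝ) ≤ γ.int.card := by exact_mod_cast Finset.card_pos.2 hv.2.1.1
      have h3 := Wtr_nonneg β lam h γ
      have h4 : 0 ≤ Real.exp (-(β - 5)) ^ γ.len := by positivity
      have h5 := mul_le_mul_of_nonneg_right h2 h4
      rw [zero_add, div_le_iff₀ (by linarith)]
      nlinarith)
  have hz : ∑ S ∈ cS h U, ∏ _γ ∈ S, (0 : ℝ) = 1 := by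
    rw [Finset.sum_eq_single_of_mem ∅ (cS_empty h U)]
    · simp
    · intro S _ hS
      obtain ⟨γ, hγ⟩ := Finset.nonempty_iff_ne_empty.2 hS
      exact Finset.prod_eq_zero hγ rfl
  refine hg.trans ?_
  rw [hz, one_mul, ← Finset.mul_sum]
  apply Real.exp_le_exp.2
  have hs := sum_int h U (Real.exp (-(β - 5))) (Real.exp_pos _).le hx
  linarith

lemma log_Ztr (β lam : ℝ) (h : ℕ) (U : Finset Site) (hx : 324 * Real.exp (-(β - 5)) ≤ 1) :
    Real.log (Ztr β lam (constSign .free) (h : ℤ) U) =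
      -lam * (h : ℝ) * (U.card : ℝ) + Real.log (Xi β lam h U) := by
  have := Xi_ge β lam h U hx
  rw [Ztr_eq β lam h U hx, Real.log_mul (Real.exp_pos _).ne' (by linarith), Real.log_exp]

lemma box_card_pos (n : ℕ) : 0 < ((box n).card : ℝ) := by
  have : (box n).Nonempty := ⟨(0, 0), by simp [box]; positivity⟩
  exact_mod_cast Finset.card_pos.2 this

lemma ftr_lip (β : ℝ) (hβ : 0 ≤ β) (hx : 324 * Real.exp (-(β - 5)) ≤ 1) (ftr : ℕ → ℝ → ℝ)
    (hf : FTRlimit β ftr) (h : ℕ) (lam lam' : ℝ) (hl : 0 < lam) (hl1 : lam ≤ 1)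
    (hl' : 0 < lam') (hl1' : lam' ≤ 1) :
    ftr h lam' + lam' * h ≤ ftr h lam + lam * h +
      2592 * Real.exp (-(β - 5)) * |lam' - lam| := by
  have t1 := hf h lam hl hl1 (constSign .free)
  have t2 := hf h lam' hl' hl1' (constSign .free)
  refine le_of_tendsto_of_tendsto' (t2.add_const (lam' * h))
    ((t1.add_const (lam * h)).add_const (2592 * Real.exp (-(β - 5)) * |lam' - lam|)) fun n => ?_
  have hc := box_card_pos n
  rw [log_Ztr _ _ _ _ hx, log_Ztr _ _ _ _ hx]
  have g1 := Xi_ge β lam h (box n) hx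
  have g2 := Xi_ge β lam' h (box n) hx
  have g3 := Real.log_le_log (by linarith) (Xi_lip β lam lam' hβ hl hl' h (box n) hx)
  rw [Real.log_mul (by linarith) (Real.exp_pos _).ne', Real.log_exp] at g3
  have g4 := div_le_div_of_nonneg_right g3 hc.le
  rw [add_div, mul_div_assoc, div_self hc.ne'] at g4
  rw [add_div, add_div, mul_div_assoc, mul_div_assoc (-lam * h), div_self hc.ne']
  linarith

lemma ftr_zero_nonneg (β : ℝ) (hx : 324 * Real.exp (-(β - 5)) ≤ 1) (ftr : ℕ → ℝ → ℝ)
    (hf : FTRlimit β ftr) (lam : ℝ) (hl : 0 < lam) (hl1 : lam ≤ 1) : 0 ≤ ftr 0 lam := by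
  refine ge_of_tendsto' (hf 0 lam hl hl1 (constSign .free)) fun n => ?_
  rw [log_Ztr _ _ _ _ hx]
  have := Real.log_nonneg (Xi_ge β lam 0 (box n) hx)
  refine div_nonneg ?_ (box_card_pos n).le
  push_cast
  linarith

lemma ftr_le (β : ℝ) (hx : 324 * Real.exp (-(β - 5)) ≤ 1) (ftr : ℕ → ℝ → ℝ)
    (hf : FTRlimit β ftr) (h : ℕ) (lam : ℝ) (hl : 0 < lam) (hl1 : lam ≤ 1) :
    ftr h lam ≤ -lam * h + 1296 * Real.exp (-(β - 5)) := by
  refine le_of_tendsto' (hf h lam hl hl1 (constSign .free)) fun n => ?_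
  rw [log_Ztr _ _ _ _ hx]
  have g1 := Xi_ge β lam h (box n) hx
  have g3 := Real.log_le_log (by linarith) (Xi_le β lam h (box n) hx)
  rw [Real.log_exp] at g3
  rw [div_le_iff₀ (box_card_pos n)]
  linarith

lemma lamc_le (β : ℝ) (hx : 5184 * Real.exp (-(β - 5)) < 1) (ftr : ℕ → ℝ → ℝ)
    (lamc : ℕ → ℝ) (hf : FTRlimit β ftr) (hc : CritSeq ftr lamc) (k : ℕ) : lamc k ≤ 1 := by
  obtain ⟨ha, hpos, ht, hm, _⟩ := hc
  have hx0 := Real.exp_pos (-(β - 5))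
  have hx' : 324 * Real.exp (-(β - 5)) ≤ 1 := by linarith
  have hex : ∃ i, lamc i < 1 := (ht.eventually_lt_const zero_lt_one).exists
  classical
  let i := Nat.find hex
  have hi : lamc i < 1 := Nat.find_spec hex
  have hi0 : i = 0 := by
    by_contra hne
    have hprev : 1 ≤ lamc (i - 1) := not_lt.1 (Nat.find_min hex (by change i - 1 < i; omega))
    obtain ⟨lam, h1, h2⟩ := exists_between (max_lt hi (by norm_num : (1 / 2 : ℝ) < 1))
    have h3 := lt_of_le_of_lt (le_max_left _ _) h1
    have h4 := lt_of_le_of_lt (le_max_right _ _) h1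
    have hl : 0 < lam := by linarith
    have g1 := hm i lam hl h2.le h3 (Or.inr (by linarith)) 0 (Ne.symm hne)
    have g2 := ftr_zero_nonneg β hx' ftr hf lam hl h2.le
    have g3 := ftr_le β hx' ftr hf i lam hl h2.le
    have g4 : (1 : ℝ) ≤ i := by exact_mod_cast Nat.one_le_iff_ne_zero.2 hne
    nlinarith
  rw [hi0] at hi
  exact (ha.antitone (Nat.zero_le k)).trans hi.le

end FinalPart

/-- Corollary 4.7 of the paper. There are an absolute `β₀` and
`ε_β > 0` with `ε_β → 0` as `β → ∞` such that for `β > β₀`, with `ftr` the truncated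
free energies and `lamc` the critical sequence: for every `k` and `0 < λ ≤ 1`, if
`λ < λ_c^{(k)}` then
`(1-ε_β)(λ_c^{(k)} - λ) ≤ f^tr_{k+1}(λ) - f^tr_k(λ) ≤ (1+ε_β)(λ_c^{(k)} - λ)`, and if
`λ > λ_c^{(k)}` then
`(1-ε_β)(λ - λ_c^{(k)}) ≤ f^tr_k(λ) - f^tr_{k+1}(λ) ≤ (1+ε_β)(λ - λ_c^{(k)})`. -/
theorem statement14 :
    ∃ β₀ : ℝ, ∃ εf : ℝ → ℝ, (∀ b : ℝ, 0 < εf b) ∧ Tendsto εf atTop (nhds 0) ∧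
      ∀ β : ℝ, β₀ < β →
        ∀ ftr : ℕ → ℝ → ℝ, ∀ lamc : ℕ → ℝ, FTRlimit β ftr → CritSeq ftr lamc →
          ∀ k : ℕ, ∀ lam : ℝ, 0 < lam → lam ≤ 1 →
            ((lam < lamc k →
                (1 - εf β) * (lamc k - lam) ≤ ftr (k + 1) lam - ftr k lam ∧
                ftr (k + 1) lam - ftr k lam ≤ (1 + εf β) * (lamc k - lam)) ∧
             (lamc k < lam →
                (1 - εf β) * (lam - lamc k) ≤ ftr k lam - ftr (k + 1) lam ∧
                ftr k lam - ftr (k + 1) lam ≤ (1 + εf β) * (lam - lamc k))) := by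
  refine ⟨5 + Real.log 5184, fun b => 5184 * Real.exp (-(b - 5)), fun b => by positivity, ?_, ?_⟩
  · have h1 : Tendsto (fun b : ℝ => b - 5) atTop atTop := tendsto_atTop_add_const_right _ _ tendsto_id
    have h2 := (Real.tendsto_exp_neg_atTop_nhds_zero.comp h1).const_mul 5184
    simpa [Function.comp_def] using h2
  intro β hβ ftr lamc hf hc k lam hl hl1
  have hlog : 0 ≤ Real.log 5184 := Real.log_nonneg (by norm_num)
  have hβ0 : 0 ≤ β := by linarith
  have hx : 5184 * Real.exp (-(β - 5)) < 1 := by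
    have : Real.exp (-(β - 5)) < Real.exp (-Real.log 5184) := Real.exp_lt_exp.2 (by linarith)
    rw [Real.exp_neg (Real.log 5184), Real.exp_log (by norm_num)] at this
    linarith
  have hx0 := Real.exp_pos (-(β - 5))
  have hx' : 324 * Real.exp (-(β - 5)) ≤ 1 := by linarith
  have hk0 : 0 < lamc k := hc.2.1 k
  have hk1 := lamc_le β hx ftr lamc hf hc k
  have heq := (hc.2.2.2.2 k).1
  have a1 := ftr_lip β hβ0 hx' ftr hf k lam (lamc k) hl hl1 hk0 hk1
  have a2 := ftr_lip β hβ0 hx' ftr hf k (lamc k) lam hk0 hk1 hl hl1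
  have a3 := ftr_lip β hβ0 hx' ftr hf (k + 1) lam (lamc k) hl hl1 hk0 hk1
  have a4 := ftr_lip β hβ0 hx' ftr hf (k + 1) (lamc k) lam hk0 hk1 hl hl1
  push_cast at a3 a4
  dsimp only
  constructor
  · intro hlt
    rw [abs_of_pos (by linarith)] at a1 a3
    rw [abs_of_neg (by linarith)] at a2 a4
    constructor <;> linarith
  · intro hlt
    rw [abs_of_neg (by linarith)] at a1 a3
    rw [abs_of_pos (by linarith)] at a2 a4
    constructor <;> linarith
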